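/- Let K be a number field and φ(z) = a_0 + a_1 z + ⋯ + a_d z^d ∈ K[z] a polynomial of degree d ≥ 2, and let v ∈ M_K be a non-archimedean place at which φ has good reduction, i.e. |a_i|_v ≤ 1 for all i and |a_d|_v = 1. Fix positive integers e and f. Then there exists a constant C = C(e,f,v) > 0 such that ĥ_φ(α) ≥ C for all but finitely many α ∈ K̄ that are totally v-adic of type (e,f). In particular, only finitely many preperiodic points of φ in K̄ are totally v-adic of type (e,f). -/

import Mathlib

open Filter

/-- `log⁺ t = log (max t 1)`. -/
noncomputable def logPlus (t : ℝ) : ℝ := Real.log (max t 1)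

/-- The `n`-th iterate of the polynomial map `z ↦ φ(z)`. -/
noncomputable def polyIter {L : Type*} [CommRing L] (φ : Polynomial L) (n : ℕ) : L → L :=
  (fun w => Polynomial.eval w φ)^[n]

/-- A "completed algebraically closed local field" `C_v`: an algebraically closed field,
complete with respect to a nontrivial (multiplicative) absolute value, recorded as the
norm of a normed-field structure. -/
structure PlaceField where
  carrier : Type
  [nf : NormedField carrier]
  [cs : CompleteSpace carrier]
  [ac : IsAlgClosed carrier]
  nontrivial : ∃ x : carrier, 1 < ‖x‖

attribute [instance] PlaceField.nf PlaceField.cs PlaceField.ac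

/-- Adelic data for a field `K`: a family of places `v`, for each place a completed
algebraically closed field `C_v` together with an embedding of a fixed algebraic
closure `K̄` of `K` into `C_v`, and weights `n_v > 0` such that the normalized absolute
values `‖x‖_v = |x|_v^{n_v}` of any nonzero `x ∈ K` are `1` for all but finitely many `v`
and satisfy the product formula `∏_v ‖x‖_v = 1`. -/
structure AdelicData (K : Type) [Field K] where
  V : Type
  C : V → PlaceField
  emb : ∀ v : V, AlgebraicClosure K →+* (C v).carrier
  nv : V → ℝ
  nv_pos : ∀ v, 0 < nv v
  finite_support : ∀ x : K, x ≠ 0 →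
    {v : V | ‖emb v (algebraMap K (AlgebraicClosure K) x)‖ ≠ 1}.Finite
  product_formula : ∀ x : K, x ≠ 0 →
    ∏ᶠ v : V, ‖emb v (algebraMap K (AlgebraicClosure K) x)‖ ^ nv v = 1

/-- The Galois orbit of `α ∈ K̄` over `K`. -/
def galOrbit (K : Type) [Field K] (α : AlgebraicClosure K) : Set (AlgebraicClosure K) :=
  Set.range fun σ : AlgebraicClosure K ≃ₐ[K] AlgebraicClosure K => σ α

/-- A subset of `K̄` is Galois-stable if it is stable under `Gal(K̄/K)`. -/
def GaloisStable (K : Type) [Field K] (S : Set (AlgebraicClosure K)) : Prop :=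
  ∀ σ : AlgebraicClosure K ≃ₐ[K] AlgebraicClosure K, σ '' S = S

namespace AdelicData

variable {K : Type} [Field K] (A : AdelicData K)

/-- The embedding of `K` itself in `C_v`. -/
noncomputable def embK (v : A.V) : K →+* (A.C v).carrier :=
  (A.emb v).comp (algebraMap K (AlgebraicClosure K))

/-- The local summand `∑_v n_v log⁺ |z|_v` of the height of `z ∈ K̄`. -/
noncomputable def locHeight (z : AlgebraicClosure K) : ℝ :=
  ∑ᶠ v : A.V, A.nv v * logPlus ‖A.emb v z‖

/-- The absolute logarithmic Weil height of a finite (Galois-stable) subset `S ⊆ K̄`: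
the average over `S` of the sums of normalized local heights. -/
noncomputable def heightSet (S : Set (AlgebraicClosure K)) : ℝ :=
  (S.ncard : ℝ)⁻¹ * ∑ᶠ z ∈ S, A.locHeight z

/-- The canonical height `ĥ_φ(S) = lim_n d^{-n} h(φ^n(S))` attached to a polynomial
`φ ∈ K[z]` of degree `d` (the limit exists; `Filter.limUnder` extracts it). -/
noncomputable def canonicalHeight (φ : Polynomial K) (S : Set (AlgebraicClosure K)) : ℝ :=
  limUnder atTop fun n : ℕ => ((φ.natDegree : ℝ) ^ n)⁻¹ *
    A.heightSet (polyIter (φ.map (algebraMap K (AlgebraicClosure K))) n '' S)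

/-- The height of a single algebraic number: the height of its Galois orbit. -/
noncomputable def heightAlg (α : AlgebraicClosure K) : ℝ := A.heightSet (galOrbit K α)

/-- The canonical height of a single algebraic number. -/
noncomputable def canonicalHeightAlg (φ : Polynomial K) (α : AlgebraicClosure K) : ℝ :=
  A.canonicalHeight φ (galOrbit K α)

/-- The Northcott finiteness property: for every bound on the degree and on the height
there are only finitely many elements of `K̄` of degree and height at most those bounds. -/
def Northcott : Prop :=
  ∀ (n : ℕ) (B : ℝ),
    {α : AlgebraicClosure K | (minpoly K α).natDegree ≤ n ∧ A.heightAlg α ≤ B}.Finite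

end AdelicData

/-- The filled Julia set of the polynomial `φ` over a normed field. -/
noncomputable def filledJulia {L : Type*} [NormedField L] (φ : Polynomial L) : Set L :=
  {z : L | ¬ Tendsto (fun n : ℕ => ‖polyIter φ n z‖) atTop atTop}

/-- The product of pairwise distances `∏_{i ≠ j} d(x i, x j)`. -/
noncomputable def pairDistProd {α : Type*} (d : α → α → ℝ) {n : ℕ} (x : Fin n → α) : ℝ :=
  ∏ i : Fin n, ∏ j : Fin n, if i = j then 1 else d (x i) (x j)

/-- The `n`-th diameter `d_n(A)` of a set `A` with respect to a distance function `d`. -/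
noncomputable def nthDiam {α : Type*} (d : α → α → ℝ) (A : Set α) (n : ℕ) : ℝ :=
  sSup {r : ℝ | ∃ x : Fin n → α, (∀ i, x i ∈ A) ∧
    r = pairDistProd d x ^ (((n : ℝ) * ((n : ℝ) - 1))⁻¹)}

/-- The transfinite diameter `c(A)`. -/
noncomputable def transDiam {α : Type*} (d : α → α → ℝ) (A : Set α) : ℝ :=
  ⨅ n : ℕ, nthDiam d A (n + 2)

section LocalExtensions

variable {X : Type*} [NormedField X]

/-- `E` is finite over `Kv` (inside the ambient valued field `X`): there is a finite
family of elements of `E` spanning `E` as a `Kv`-module. -/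
def FiniteOver (Kv E : Subfield X) : Prop :=
  ∃ (n : ℕ) (b : Fin n → X), (∀ i, b i ∈ E) ∧
    ∀ x ∈ E, ∃ a : Fin n → X, (∀ i, a i ∈ Kv) ∧ x = ∑ i, a i * b i

/-- The ramification index of `E` over `Kv` is at most `e`: the value group `|E^×|` is
covered by `e` cosets of the value group `|Kv^×|`. -/
def RamIndexLe (Kv E : Subfield X) (e : ℕ) : Prop :=
  ∃ t : Fin e → X, (∀ i, t i ∈ E ∧ t i ≠ 0) ∧
    ∀ x ∈ E, x ≠ 0 → ∃ i, ∃ y ∈ Kv, y ≠ 0 ∧ ‖x‖ = ‖t i‖ * ‖y‖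

/-- The residue degree of `E` over `Kv` is at most `f`: the residue field of `E` is
spanned, over the residue field of `Kv`, by (the reductions of) `f` integral elements
of `E`. -/
def ResDegreeLe (Kv E : Subfield X) (f : ℕ) : Prop :=
  ∃ s : Fin f → X, (∀ i, s i ∈ E ∧ ‖s i‖ ≤ 1) ∧
    ∀ x ∈ E, ‖x‖ ≤ 1 → ∃ a : Fin f → X,
      (∀ i, a i ∈ Kv ∧ ‖a i‖ ≤ 1) ∧ ‖x - ∑ i, a i * s i‖ < 1

end LocalExtensions

/-- `α ∈ K̄` is totally `v`-adic of type `(e,f)`: for every `K`-embedding `τ` of `K̄`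
into `C_v`, the image of `K(α)` is contained in a finite extension `E` of `K_v`
(inside `C_v`) whose ramification index over `K_v` is at most `e` and whose residue
degree over `K_v` is at most `f`. -/
def TotallyVadicOfType {K : Type} [Field K] (A : AdelicData K) (v : A.V)
    (Kv : Subfield (A.C v).carrier) (e f : ℕ) (α : AlgebraicClosure K) : Prop :=
  ∀ τ : AlgebraicClosure K →+* (A.C v).carrier,
    (∀ x : K, τ (algebraMap K (AlgebraicClosure K) x) = A.embK v x) →
    ∃ E : Subfield (A.C v).carrier, Kv ≤ E ∧ FiniteOver Kv E ∧
      RamIndexLe Kv E e ∧ ResDegreeLe Kv E f ∧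
      ∀ β ∈ IntermediateField.adjoin K {α}, τ β ∈ E

/-- A point of `K̄` is preperiodic for `φ ∈ K[z]` if its forward orbit is finite. -/
def IsPreperiodicAlg {K : Type} [Field K] (φ : Polynomial K)
    (z : AlgebraicClosure K) : Prop :=
  (Set.range fun n : ℕ =>
    polyIter (φ.map (algebraMap K (AlgebraicClosure K))) n z).Finite

theorem isUltrametricDist_of_norm_two_le_one {L : Type*} [NormedField L] (h : ‖(2 : L)‖ ≤ 1) :
    IsUltrametricDist L := by
  have key : ∀ k n : ℕ, n < 2 ^ k → ‖(n : L)‖ ≤ k := by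
    intro k
    induction k with
    | zero => intro n hn; obtain rfl : n = 0 := by simpa using hn
              simp
    | succ k ih =>
      intro n hn
      have h1 := ih (n / 2) (by rw [pow_succ] at hn; omega)
      have h2 : (n : L) = 2 * ((n / 2 : ℕ) : L) + ((n % 2 : ℕ) : L) := by
        exact_mod_cast congrArg (Nat.cast (R := L)) (Nat.div_add_mod n 2).symm
      have h3 : ‖((n % 2 : ℕ) : L)‖ ≤ 1 := by
        rcases Nat.mod_two_eq_zero_or_one n with h | h <;> simp [h]
      calc ‖(n : L)‖ ≤ ‖(2 : L) * ((n / 2 : ℕ) : L)‖ + ‖((n % 2 : ℕ) : L)‖ := by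
            conv_lhs => rw [h2]
            exact norm_add_le _ _
        _ ≤ 1 * k + 1 := by
            rw [norm_mul]
            gcongr
        _ = ((k + 1 : ℕ) : ℝ) := by push_cast; ring
  refine IsUltrametricDist.isUltrametricDist_of_forall_norm_natCast_le_one fun n => ?_
  by_contra! hn
  obtain ⟨k, hk⟩ : ∃ k, n < 2 ^ k := ⟨n, Nat.lt_two_pow_self⟩
  have h1 : ∀ m : ℕ, m ≠ 0 → ‖(n : L)‖ ^ m ≤ k * m := by
    intro m hm
    have := key (k * m) (n ^ m) (by rw [pow_mul]; exact Nat.pow_lt_pow_left hk hm)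
    simpa using this
  have h2 := tendsto_pow_const_div_const_pow_of_one_lt 1 hn
  have h3 := (h2.const_mul (k : ℝ)).eventually_lt_const (u := 1) (by simp)
  obtain ⟨m, hm, hm0⟩ := (h3.and (eventually_ne_atTop 0)).exists
  have h4 := h1 m hm0
  have h5 : 0 < ‖(n : L)‖ ^ m := by positivity
  rw [pow_one, ← mul_div_assoc, div_lt_one h5] at hm
  linarith

theorem logPlus_nonneg (t : ℝ) : 0 ≤ logPlus t := Real.log_nonneg (le_max_right _ _)

theorem logPlus_eq_zero {t : ℝ} (h : t ≤ 1) : logPlus t = 0 := by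
  simp [logPlus, max_eq_right h]

theorem logPlus_eq_log {t : ℝ} (h : 1 ≤ t) : logPlus t = Real.log t := by
  simp [logPlus, max_eq_left h]

theorem exp_logPlus (t : ℝ) : Real.exp (logPlus t) = max t 1 :=
  Real.exp_log (lt_of_lt_of_le one_pos (le_max_right _ _))

theorem log_le_logPlus {t : ℝ} (h : 0 ≤ t) : Real.log t ≤ logPlus t := by
  rcases h.eq_or_lt with rfl | h
  · simpa using logPlus_nonneg 0
  · exact Real.log_le_log h (le_max_left _ _)

section Local

open Polynomial

variable {L : Type*} [NormedField L]

theorem norm_eval_le_one [IsUltrametricDist L] {p : L[X]} (h : ∀ i, ‖p.coeff i‖ ≤ 1) {z : L}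
    (hz : ‖z‖ ≤ 1) : ‖p.eval z‖ ≤ 1 := by
  rw [eval_eq_sum_range]
  refine IsUltrametricDist.norm_sum_le_of_forall_le_of_nonneg zero_le_one fun i _ => ?_
  rw [norm_mul, norm_pow]
  exact mul_le_one₀ (h i) (by positivity) (pow_le_one₀ (norm_nonneg _) hz)

theorem norm_eval_eq_pow [IsUltrametricDist L] {p : L[X]} (h : ∀ i, ‖p.coeff i‖ ≤ 1)
    (hl : ‖p.leadingCoeff‖ = 1) {z : L} (hz : 1 < ‖z‖) : ‖p.eval z‖ = ‖z‖ ^ p.natDegree := by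
  have h0 : ‖p.coeff p.natDegree * z ^ p.natDegree‖ = ‖z‖ ^ p.natDegree := by
    rw [norm_mul, norm_pow, coeff_natDegree, hl, one_mul]
  have h1 : ‖∑ i ∈ Finset.range p.natDegree, p.coeff i * z ^ i‖ < ‖z‖ ^ p.natDegree := by
    rcases Nat.eq_zero_or_pos p.natDegree with hd | hd
    · simp [hd]
    · refine lt_of_le_of_lt (b := ‖z‖ ^ (p.natDegree - 1)) ?_
        (pow_lt_pow_right₀ hz (by omega))
      refine IsUltrametricDist.norm_sum_le_of_forall_le_of_nonneg (by positivity) fun i hi => ?_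
      rw [norm_mul, norm_pow]
      have : i ≤ p.natDegree - 1 := by have := Finset.mem_range.1 hi; omega
      calc ‖p.coeff i‖ * ‖z‖ ^ i ≤ 1 * ‖z‖ ^ (p.natDegree - 1) := by
            gcongr
            · exact h i
            · exact hz.le
        _ = _ := one_mul _
  rw [eval_eq_sum_range, Finset.sum_range_succ,
    IsUltrametricDist.norm_add_eq_max_of_norm_ne_norm (by rw [h0]; exact h1.ne), h0,
    max_eq_right h1.le]

theorem logPlus_norm_eval_eq [IsUltrametricDist L] {p : L[X]} (h : ∀ i, ‖p.coeff i‖ ≤ 1)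
    (hl : ‖p.leadingCoeff‖ = 1) (z : L) :
    logPlus ‖p.eval z‖ = p.natDegree * logPlus ‖z‖ := by
  rcases le_or_gt ‖z‖ 1 with hz | hz
  · rw [logPlus_eq_zero hz, logPlus_eq_zero (norm_eval_le_one h hz), mul_zero]
  · rw [norm_eval_eq_pow h hl hz, logPlus_eq_log (one_le_pow₀ hz.le), logPlus_eq_log hz.le,
      Real.log_pow]

theorem exists_abs_logPlus_norm_eval_sub_le {p : L[X]} (hd : 0 < p.natDegree) :
    ∃ c : ℝ, ∀ z : L, |logPlus ‖p.eval z‖ - p.natDegree * logPlus ‖z‖| ≤ c := by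
  set d := p.natDegree with hd'
  set a := ‖p.leadingCoeff‖ with ha
  have ha0 : 0 < a := by
    rw [ha, norm_pos_iff, leadingCoeff_ne_zero]; rintro rfl; simp [hd'] at hd
  set B := ∑ i ∈ Finset.range d, ‖p.coeff i‖ with hB
  have hB0 : 0 ≤ B := Finset.sum_nonneg fun _ _ => norm_nonneg _
  set R := max 1 (2 * B / a) with hR
  have hR1 : 1 ≤ R := le_max_left _ _
  have hdecomp : ∀ z : L, p.eval z =
      (∑ i ∈ Finset.range d, p.coeff i * z ^ i) + p.leadingCoeff * z ^ d := fun z => by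
    rw [eval_eq_sum_range, Finset.sum_range_succ, coeff_natDegree]
  have hrest : ∀ z : L, 1 ≤ ‖z‖ →
      ‖∑ i ∈ Finset.range d, p.coeff i * z ^ i‖ ≤ B * ‖z‖ ^ (d - 1) := fun z hz => by
    refine (norm_sum_le _ _).trans ?_
    rw [hB, Finset.sum_mul]
    refine Finset.sum_le_sum fun i hi => ?_
    rw [norm_mul, norm_pow]
    have : i ≤ d - 1 := by have := Finset.mem_range.1 hi; omega
    gcongr
  have hupper : ∀ z : L, ‖p.eval z‖ ≤ (a + B) * (max ‖z‖ 1) ^ d := fun z => by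
    rw [hdecomp]
    refine (norm_add_le _ _).trans ?_
    have h1 : ‖∑ i ∈ Finset.range d, p.coeff i * z ^ i‖ ≤ B * (max ‖z‖ 1) ^ d := by
      refine (norm_sum_le _ _).trans ?_
      rw [hB, Finset.sum_mul]
      refine Finset.sum_le_sum fun i hi => ?_
      rw [norm_mul, norm_pow]
      have : i ≤ d := (Finset.mem_range.1 hi).le
      gcongr
      calc ‖z‖ ^ i ≤ (max ‖z‖ 1) ^ i := by gcongr; exact le_max_left _ _
        _ ≤ _ := by gcongr; exact le_max_right _ _
    have h2 : ‖p.leadingCoeff * z ^ d‖ ≤ a * (max ‖z‖ 1) ^ d := by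
      rw [norm_mul, norm_pow]; gcongr; exact le_max_left _ _
    linarith
  refine ⟨|Real.log (max (a + B) 1)| + d * Real.log R + |Real.log (a / 2)|, fun z => ?_⟩
  have hRlog : 0 ≤ Real.log R := Real.log_nonneg hR1
  have e1 := abs_nonneg (Real.log (a / 2))
  have e2 := abs_nonneg (Real.log (max (a + B) 1))
  have e3 : 0 ≤ d * Real.log R := by positivity
  rw [abs_le]
  constructor
  · rcases le_or_gt ‖z‖ R with hz | hz
    · have h1 : logPlus ‖z‖ ≤ Real.log R :=
        Real.log_le_log (by positivity) (max_le hz hR1)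
      have h2 : d * logPlus ‖z‖ ≤ d * Real.log R := by gcongr
      have := logPlus_nonneg ‖p.eval z‖
      linarith
    · have hz1 : 1 < ‖z‖ := hR1.trans_lt hz
      have hz2 : 2 * B ≤ ‖z‖ * a := by
        rw [← div_le_iff₀ ha0]; exact (le_max_right _ _).trans hz.le
      have h1 : a / 2 * ‖z‖ ^ d ≤ ‖p.eval z‖ := by
        have h2 := hrest z hz1.le
        have h3 : ‖p.leadingCoeff * z ^ d‖ = a * ‖z‖ ^ d := by rw [norm_mul, norm_pow]
        have h4 : ‖p.leadingCoeff * z ^ d‖ ≤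
            ‖p.eval z‖ + ‖∑ i ∈ Finset.range d, p.coeff i * z ^ i‖ := by
          rw [hdecomp]
          exact norm_le_add_norm_add' _ _
        have h5 : ‖z‖ ^ d = ‖z‖ * ‖z‖ ^ (d - 1) := by
          rw [← pow_succ', Nat.sub_add_cancel hd]
        have h6 : 2 * B * ‖z‖ ^ (d - 1) ≤ ‖z‖ * a * ‖z‖ ^ (d - 1) := by gcongr
        rw [h3] at h4
        have h7 : a * ‖z‖ ^ d = ‖z‖ * a * ‖z‖ ^ (d - 1) := by rw [h5]; ring
        linarith
      have h2 : Real.log (a / 2) + d * Real.log ‖z‖ ≤ Real.log ‖p.eval z‖ := by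
        rw [← Real.log_pow, ← Real.log_mul (by positivity) (by positivity)]
        exact Real.log_le_log (by positivity) h1
      have h3 := log_le_logPlus (norm_nonneg (p.eval z))
      rw [logPlus_eq_log hz1.le]
      have := neg_abs_le (Real.log (a / 2))
      linarith
  · have h1 : max ‖p.eval z‖ 1 ≤ max (a + B) 1 * (max ‖z‖ 1) ^ d := by
      refine max_le ((hupper z).trans ?_) ?_
      · gcongr; exact le_max_left _ _
      · exact one_le_mul_of_one_le_of_one_le (le_max_right _ _) (one_le_pow₀ (le_max_right _ _))
    have h2 : logPlus ‖p.eval z‖ ≤ Real.log (max (a + B) 1) + d * logPlus ‖z‖ := by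
      rw [logPlus, logPlus, ← Real.log_pow, ← Real.log_mul (by positivity) (by positivity)]
      exact Real.log_le_log (by positivity) h1
    have := le_abs_self (Real.log (max (a + B) 1))
    linarith

end Local

namespace AdelicData

variable {K : Type} [Field K] (A : AdelicData K)

theorem finite_not_isUltrametricDist [CharZero K] :
    {v : A.V | ¬ IsUltrametricDist (A.C v).carrier}.Finite := by
  refine (A.finite_support 2 two_ne_zero).subset fun v hv => ?_
  contrapose! hv
  simp only [Set.mem_ofPred_eq, not_not, ne_eq, map_ofNat] at hv ⊢
  exact isUltrametricDist_of_norm_two_le_one hv.le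

theorem finite_one_lt_norm_embK (x : K) : {v : A.V | 1 < ‖A.embK v x‖}.Finite := by
  rcases eq_or_ne x 0 with rfl | hx
  · convert! Set.finite_empty
    ext v
    simp
  · exact (A.finite_support x hx).subset fun v hv => ne_of_gt hv

theorem finite_exists_one_lt_norm_coeff (p : Polynomial K) :
    {v : A.V | ∃ i, 1 < ‖A.embK v (p.coeff i)‖}.Finite := by
  have : {v : A.V | ∃ i, 1 < ‖A.embK v (p.coeff i)‖} ⊆
      ⋃ i ∈ p.support, {v : A.V | 1 < ‖A.embK v (p.coeff i)‖} := by
    rintro v ⟨i, hi⟩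
    refine Set.mem_biUnion (x := i) ?_ hi
    simp only [Finset.mem_coe, Polynomial.mem_support_iff]
    intro h
    simp [h] at hi
    linarith
  exact (p.support.finite_toSet.biUnion fun i _ => A.finite_one_lt_norm_embK _).subset this

theorem emb_eval_map (v : A.V) (p : Polynomial K) (z : AlgebraicClosure K) :
    A.emb v ((p.map (algebraMap K (AlgebraicClosure K))).eval z) =
      (p.map (A.embK v)).eval (A.emb v z) := by
  rw [Polynomial.eval_map, Polynomial.eval_map, Polynomial.hom_eval₂]
  rfl

/-- Places which are archimedean, or at which `p` does not have good reduction. -/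
def badPlaces (p : Polynomial K) : Set A.V :=
  {v | ¬ (IsUltrametricDist (A.C v).carrier ∧ (∀ i, ‖A.embK v (p.coeff i)‖ ≤ 1) ∧
    ‖A.embK v p.leadingCoeff‖ = 1)}

theorem finite_badPlaces [CharZero K] {p : Polynomial K} (hp : p ≠ 0) :
    (A.badPlaces p).Finite := by
  refine ((A.finite_not_isUltrametricDist.union (A.finite_exists_one_lt_norm_coeff p)).union
    (A.finite_support p.leadingCoeff (Polynomial.leadingCoeff_ne_zero.2 hp))).subset
    fun v hv => ?_
  contrapose! hv
  simp only [Set.mem_union, Set.mem_ofPred_eq, not_or, not_exists, not_not, not_lt, ne_eq] at hv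
  simpa [badPlaces] using ⟨hv.1.1, hv.1.2, hv.2⟩

theorem logPlus_emb_eval_eq {p : Polynomial K} {v : A.V} (hv : v ∉ A.badPlaces p)
    (z : AlgebraicClosure K) :
    logPlus ‖A.emb v ((p.map (algebraMap K (AlgebraicClosure K))).eval z)‖ =
      p.natDegree * logPlus ‖A.emb v z‖ := by
  simp only [badPlaces, Set.mem_ofPred_eq, not_not] at hv
  obtain ⟨h1, h2, h3⟩ := hv
  rw [emb_eval_map, logPlus_norm_eval_eq (by simpa using h2), Polynomial.natDegree_map]
  rwa [Polynomial.leadingCoeff_map]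

theorem finite_one_lt_norm_emb [CharZero K] (z : AlgebraicClosure K) :
    {v : A.V | 1 < ‖A.emb v z‖}.Finite := by
  have hz : IsIntegral K z := Algebra.IsIntegral.isIntegral z
  refine (A.finite_badPlaces (minpoly.ne_zero hz)).subset fun v hv => ?_
  by_contra hbad
  have := A.logPlus_emb_eval_eq hbad z
  rw [Polynomial.eval_map_algebraMap, minpoly.aeval, map_zero, norm_zero,
    logPlus_eq_zero zero_le_one, logPlus_eq_log (le_of_lt hv)] at this
  have h1 : 0 < Real.log ‖A.emb v z‖ := Real.log_pos hv
  have h2 : (0 : ℝ) < (minpoly K z).natDegree := by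
    exact_mod_cast minpoly.natDegree_pos hz
  exact (mul_pos h2 h1).ne this

theorem locHeight_eq_sum {z : AlgebraicClosure K} {S : Finset A.V}
    (hS : ∀ v, 1 < ‖A.emb v z‖ → v ∈ S) :
    A.locHeight z = ∑ v ∈ S, A.nv v * logPlus ‖A.emb v z‖ := by
  refine finsum_eq_sum_of_support_subset _ fun v hv => hS v ?_
  by_contra! h
  exact hv (by simp [logPlus_eq_zero h])

theorem exists_abs_locHeight_eval_sub_le [CharZero K] {p : Polynomial K}
    (hp : 0 < p.natDegree) : ∃ c : ℝ, 0 ≤ c ∧ ∀ z,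
      |A.locHeight ((p.map (algebraMap K (AlgebraicClosure K))).eval z) -
        p.natDegree * A.locHeight z| ≤ c := by
  classical
  have hloc : ∀ v : A.V, ∃ c : ℝ, ∀ z : AlgebraicClosure K,
      |logPlus ‖A.emb v ((p.map (algebraMap K (AlgebraicClosure K))).eval z)‖ -
        p.natDegree * logPlus ‖A.emb v z‖| ≤ c := by
    intro v
    obtain ⟨c, hc⟩ := exists_abs_logPlus_norm_eval_sub_le (p := p.map (A.embK v))
      (by rwa [Polynomial.natDegree_map])
    refine ⟨c, fun z => ?_⟩
    rw [emb_eval_map]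
    simpa [Polynomial.natDegree_map] using hc (A.emb v z)
  choose c hc using hloc
  have hc0 : ∀ v, 0 ≤ c v := fun v => (abs_nonneg _).trans (hc v 0)
  have hp0 : p ≠ 0 := by rintro rfl; simp at hp
  set B := (A.finite_badPlaces hp0).toFinset with hB
  refine ⟨∑ v ∈ B, A.nv v * c v,
    Finset.sum_nonneg fun v _ => mul_nonneg (A.nv_pos v).le (hc0 v), fun z => ?_⟩
  set w := (p.map (algebraMap K (AlgebraicClosure K))).eval z with hw
  set S := B ∪ (A.finite_one_lt_norm_emb z).toFinset ∪ (A.finite_one_lt_norm_emb w).toFinset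
  rw [A.locHeight_eq_sum (z := w) (S := S) (by intro v hv; simp [S, hv]),
    A.locHeight_eq_sum (z := z) (S := S) (by intro v hv; simp [S, hv]),
    Finset.mul_sum, ← Finset.sum_sub_distrib]
  refine (Finset.abs_sum_le_sum_abs _ _).trans ?_
  have hBS : B ⊆ S := fun v hv => by simp [S, hv]
  rw [← Finset.sum_subset hBS (f := fun v => |A.nv v * logPlus ‖A.emb v w‖ -
    p.natDegree * (A.nv v * logPlus ‖A.emb v z‖)|)]
  · refine Finset.sum_le_sum fun v _ => ?_
    have : A.nv v * logPlus ‖A.emb v w‖ - p.natDegree * (A.nv v * logPlus ‖A.emb v z‖) =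
        A.nv v * (logPlus ‖A.emb v w‖ - p.natDegree * logPlus ‖A.emb v z‖) := by ring
    rw [this, abs_mul, abs_of_pos (A.nv_pos v)]
    exact mul_le_mul_of_nonneg_left (hc v z) (A.nv_pos v).le
  · intro v _ hv
    have hv' : v ∉ A.badPlaces p := by simpa [hB] using hv
    rw [hw, A.logPlus_emb_eval_eq hv' z, abs_eq_zero]
    ring

theorem sum_nv_mul_log_eq_zero {x : K} (hx : x ≠ 0) {S : Finset A.V}
    (hS : ∀ v, ‖A.embK v x‖ ≠ 1 → v ∈ S) :
    ∑ v ∈ S, A.nv v * Real.log ‖A.embK v x‖ = 0 := by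
  have h1 := A.product_formula x hx
  have hpos : ∀ v, 0 < ‖A.embK v x‖ := fun v => by
    rw [norm_pos_iff]; exact (map_ne_zero _).2 hx
  rw [finprod_eq_prod_of_mulSupport_subset (s := S)] at h1
  · have h2 := congrArg Real.log h1
    rw [Real.log_one, Real.log_prod] at h2
    · rw [← h2]
      exact Finset.sum_congr rfl fun v _ => (Real.log_rpow (hpos v) _).symm
    · exact fun v _ => (Real.rpow_pos_of_pos (hpos v) _).ne'
  · intro v hv
    refine hS v fun h => hv ?_
    change ‖A.embK v x‖ ^ A.nv v = 1
    rw [h, Real.one_rpow]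

end AdelicData

section GaloisOrbit

variable {K : Type} [Field K]

theorem galOrbit_eq_rootSet (α : AlgebraicClosure K) :
    galOrbit K α = (minpoly K α).rootSet (AlgebraicClosure K) := by
  ext z
  rw [← isConjRoot_iff_mem_minpoly_rootSet (Algebra.IsIntegral.isIntegral α),
    IsConjRoot.comm, isConjRoot_iff_exists_algEquiv]
  rfl

theorem finite_galOrbit (α : AlgebraicClosure K) : (galOrbit K α).Finite := by
  rw [galOrbit_eq_rootSet]
  exact Polynomial.rootSet_finite _ _

theorem self_mem_galOrbit (α : AlgebraicClosure K) : α ∈ galOrbit K α := ⟨AlgEquiv.refl, rfl⟩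

theorem map_mem_galOrbit {α z : AlgebraicClosure K} (hz : z ∈ galOrbit K α)
    (σ : AlgebraicClosure K ≃ₐ[K] AlgebraicClosure K) : σ z ∈ galOrbit K α := by
  obtain ⟨τ, rfl⟩ := hz
  exact ⟨τ.trans σ, rfl⟩

theorem exists_map_eq_of_mem_galOrbit {α z w : AlgebraicClosure K} (hz : z ∈ galOrbit K α)
    (hw : w ∈ galOrbit K α) : ∃ σ : AlgebraicClosure K ≃ₐ[K] AlgebraicClosure K, σ z = w := by
  obtain ⟨τ, rfl⟩ := hz
  obtain ⟨ρ, rfl⟩ := hw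
  exact ⟨τ.symm.trans ρ, by simp⟩

/-- The Galois orbit as a finite set. -/
noncomputable def galFinset (α : AlgebraicClosure K) : Finset (AlgebraicClosure K) :=
  (finite_galOrbit α).toFinset

theorem mem_galFinset {α z : AlgebraicClosure K} : z ∈ galFinset α ↔ z ∈ galOrbit K α := by
  simp [galFinset]

theorem coe_galFinset (α : AlgebraicClosure K) : (galFinset α : Set _) = galOrbit K α := by
  simp [galFinset]

theorem card_galFinset [CharZero K] (α : AlgebraicClosure K) :
    (galFinset α).card = (minpoly K α).natDegree := by
  have hα : IsIntegral K α := Algebra.IsIntegral.isIntegral α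
  have h := Polynomial.card_rootSet_eq_natDegree (K := AlgebraicClosure K)
    (minpoly.irreducible hα).separable (IsAlgClosed.splits _)
  rw [← h, galFinset, ← Nat.card_eq_fintype_card, ← galOrbit_eq_rootSet,
    Nat.card_eq_card_finite_toFinset]

theorem card_galFinset_pos (α : AlgebraicClosure K) : 0 < (galFinset α).card :=
  Finset.card_pos.2 ⟨α, mem_galFinset.2 (self_mem_galOrbit α)⟩

theorem map_eval_map (σ : AlgebraicClosure K ≃ₐ[K] AlgebraicClosure K) (p : Polynomial K)
    (z : AlgebraicClosure K) :
    σ ((p.map (algebraMap K (AlgebraicClosure K))).eval z) =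
      (p.map (algebraMap K (AlgebraicClosure K))).eval (σ z) := by
  rw [Polynomial.eval_map_algebraMap, Polynomial.eval_map_algebraMap]
  exact (Polynomial.aeval_algHom_apply σ.toAlgHom z p).symm

theorem image_galOrbit_of_commute {g : AlgebraicClosure K → AlgebraicClosure K}
    (hg : ∀ (σ : AlgebraicClosure K ≃ₐ[K] AlgebraicClosure K) z, σ (g z) = g (σ z))
    (α : AlgebraicClosure K) : g '' galOrbit K α = galOrbit K (g α) := by
  rw [galOrbit, galOrbit, ← Set.range_comp]
  congr 1
  ext σ
  exact (hg σ α).symm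

theorem map_polyIter (φ : Polynomial K) (n : ℕ)
    (σ : AlgebraicClosure K ≃ₐ[K] AlgebraicClosure K) (z : AlgebraicClosure K) :
    σ (polyIter (φ.map (algebraMap K (AlgebraicClosure K))) n z) =
      polyIter (φ.map (algebraMap K (AlgebraicClosure K))) n (σ z) := by
  induction n generalizing z with
  | zero => rfl
  | succ n ih =>
    simp only [polyIter, Function.iterate_succ, Function.comp_apply] at ih ⊢
    rw [ih, map_eval_map]

end GaloisOrbit

theorem exists_tendsto_of_abs_succ_sub_le {u : ℕ → ℝ} {d : ℕ} (hd : 2 ≤ d) {c : ℝ} (hc0 : 0 ≤ c)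
    (hu : ∀ n, |u (n + 1) - d * u n| ≤ c) :
    ∃ l : ℝ, Tendsto (fun n => ((d : ℝ) ^ n)⁻¹ * u n) atTop (nhds l) ∧
      ∀ n, |l - ((d : ℝ) ^ n)⁻¹ * u n| ≤ ((d : ℝ) ^ n)⁻¹ * c := by
  have hd' : (2 : ℝ) ≤ d := by exact_mod_cast hd
  have hr : (d : ℝ)⁻¹ < 1 := inv_lt_one_of_one_lt₀ (by linarith)
  set g : ℕ → ℝ := fun n => ((d : ℝ) ^ n)⁻¹ * u n with hg
  have hstep : ∀ n, dist (g n) (g (n + 1)) ≤ (c / d) * (d : ℝ)⁻¹ ^ n := by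
    intro n
    rw [dist_comm, Real.dist_eq]
    have : g (n + 1) - g n = ((d : ℝ) ^ (n + 1))⁻¹ * (u (n + 1) - d * u n) := by
      simp only [hg]; field_simp; ring
    rw [this, abs_mul, abs_of_pos (by positivity)]
    calc _ ≤ ((d : ℝ) ^ (n + 1))⁻¹ * c := by gcongr; exact hu n
      _ = _ := by rw [inv_pow]; field_simp; ring
  obtain ⟨l, hl⟩ := cauchySeq_tendsto_of_complete (cauchySeq_of_le_geometric _ _ hr hstep)
  refine ⟨l, hl, fun n => ?_⟩
  have h := dist_le_of_le_geometric_of_tendsto _ _ hr hstep hl n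
  rw [dist_comm, Real.dist_eq] at h
  refine h.trans ?_
  have e : c / d * (d : ℝ)⁻¹ ^ n / (1 - (d : ℝ)⁻¹) = ((d : ℝ) ^ n)⁻¹ * (c / (d - 1)) := by
    have : (d : ℝ) - 1 ≠ 0 := by linarith
    rw [inv_pow]
    field_simp
  rw [e]
  gcongr
  exact div_le_self hc0 (by linarith)

namespace AdelicData

variable {K : Type} [Field K] (A : AdelicData K)

theorem heightSet_image_galOrbit {g : AlgebraicClosure K → AlgebraicClosure K}
    (hg : ∀ (σ : AlgebraicClosure K ≃ₐ[K] AlgebraicClosure K) z, σ (g z) = g (σ z))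
    (α : AlgebraicClosure K) :
    A.heightSet (g '' galOrbit K α) =
      ((galFinset α).card : ℝ)⁻¹ * ∑ z ∈ galFinset α, A.locHeight (g z) := by
  classical
  set X := galFinset α with hX
  have hset : g '' galOrbit K α = ((X.image g : Finset _) : Set _) := by
    rw [Finset.coe_image, coe_galFinset]
  rw [heightSet, hset, Set.ncard_coe_finset, finsum_mem_coe_finset]
  set m := (X.filter fun z => g z = g α).card with hm
  have hfib : ∀ y ∈ X.image g, (X.filter fun z => g z = y).card = m := by
    intro y hy
    obtain ⟨x, hx, rfl⟩ := Finset.mem_image.1 hy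
    obtain ⟨σ, hσ⟩ := exists_map_eq_of_mem_galOrbit (mem_galFinset.1 hx) (self_mem_galOrbit α)
    refine Finset.card_bij (fun z _ => σ z) ?_ (fun _ _ _ _ h => σ.injective h) ?_
    · intro z hz
      rw [Finset.mem_filter] at hz ⊢
      exact ⟨mem_galFinset.2 (map_mem_galOrbit (mem_galFinset.1 hz.1) σ), by
        rw [← hg, hz.2, hg, hσ]⟩
    · intro z hz
      rw [Finset.mem_filter] at hz
      refine ⟨σ.symm z, ?_, by simp⟩
      rw [Finset.mem_filter]
      refine ⟨mem_galFinset.2 (map_mem_galOrbit (mem_galFinset.1 hz.1) σ.symm), ?_⟩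
      rw [← hg, hz.2, ← hσ, ← hg, AlgEquiv.symm_apply_apply]
  have hm0 : 0 < m := Finset.card_pos.2
    ⟨α, by simp [hX, mem_galFinset, self_mem_galOrbit]⟩
  have hsum : ∑ z ∈ X, A.locHeight (g z) = m * ∑ y ∈ X.image g, A.locHeight y := by
    rw [Finset.sum_comp, Finset.mul_sum]
    refine Finset.sum_congr rfl fun y hy => ?_
    rw [hfib y hy, nsmul_eq_mul]
  have hcard : X.card = m * (X.image g).card := by
    rw [Finset.card_eq_sum_card_image g X, Finset.sum_congr rfl hfib, Finset.sum_const,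
      smul_eq_mul, mul_comm]
  rw [hsum, hcard]
  have hm' : (m : ℝ) ≠ 0 := by positivity
  push_cast
  field_simp

theorem heightAlg_eq (α : AlgebraicClosure K) :
    A.heightAlg α = ((galFinset α).card : ℝ)⁻¹ * ∑ z ∈ galFinset α, A.locHeight z := by
  have := A.heightSet_image_galOrbit (g := id) (fun _ _ => rfl) α
  simpa [heightAlg] using this

/-- There is a constant `c` bounding the difference of `d ^ (-n) h(φ^n(α))` and `ĥ_φ(α)` by
`c d ^ (-n)`, uniformly in `α`. -/
theorem exists_tendsto_canonicalHeightAlg [CharZero K] {φ : Polynomial K}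
    (hd : 2 ≤ φ.natDegree) :
    ∃ c : ℝ, 0 ≤ c ∧ ∀ α,
      Tendsto (fun n : ℕ => ((φ.natDegree : ℝ) ^ n)⁻¹ *
        A.heightAlg (polyIter (φ.map (algebraMap K (AlgebraicClosure K))) n α)) atTop
        (nhds (A.canonicalHeightAlg φ α)) ∧
      ∀ n : ℕ, |A.canonicalHeightAlg φ α - ((φ.natDegree : ℝ) ^ n)⁻¹ *
        A.heightAlg (polyIter (φ.map (algebraMap K (AlgebraicClosure K))) n α)| ≤
          ((φ.natDegree : ℝ) ^ n)⁻¹ * c := by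
  obtain ⟨c, hc0, hc⟩ := A.exists_abs_locHeight_eval_sub_le (p := φ) (by omega)
  refine ⟨c, hc0, fun α => ?_⟩
  set ψ := φ.map (algebraMap K (AlgebraicClosure K)) with hψ
  set u : ℕ → ℝ := fun n => A.heightAlg (polyIter ψ n α) with hu
  have hu' : ∀ n, u n = A.heightSet (polyIter ψ n '' galOrbit K α) := fun n => by
    rw [image_galOrbit_of_commute (map_polyIter φ n)]; rfl
  have hu'' : ∀ n, u n = ((galFinset α).card : ℝ)⁻¹ *
      ∑ z ∈ galFinset α, A.locHeight (polyIter ψ n z) := fun n => by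
    rw [hu', A.heightSet_image_galOrbit (map_polyIter φ n)]
  have hstep : ∀ n, |u (n + 1) - φ.natDegree * u n| ≤ c := by
    intro n
    have hN : (0 : ℝ) < (galFinset α).card := by exact_mod_cast card_galFinset_pos α
    have e : u (n + 1) - φ.natDegree * u n = ((galFinset α).card : ℝ)⁻¹ *
        ∑ z ∈ galFinset α, (A.locHeight (ψ.eval (polyIter ψ n z)) -
          φ.natDegree * A.locHeight (polyIter ψ n z)) := by
      rw [Finset.sum_sub_distrib, ← Finset.mul_sum, hu'', hu'']
      simp only [polyIter, Function.iterate_succ_apply']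
      ring
    rw [e, abs_mul, abs_of_pos (by positivity), inv_mul_le_iff₀ hN, ← nsmul_eq_mul]
    exact (Finset.abs_sum_le_sum_abs _ _).trans
      (Finset.sum_le_card_nsmul _ _ _ fun z _ => hc _)
  obtain ⟨l, hl, hl'⟩ := exists_tendsto_of_abs_succ_sub_le hd hc0 hstep
  have : A.canonicalHeightAlg φ α = l := by
    refine Tendsto.limUnder_eq ?_
    simp only [hu'] at hl
    exact hl
  rw [this]
  exact ⟨hl, hl'⟩

theorem canonicalHeightAlg_eq_zero_of_isPreperiodicAlg [CharZero K] {φ : Polynomial K}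
    (hd : 2 ≤ φ.natDegree) {α : AlgebraicClosure K} (hα : IsPreperiodicAlg φ α) :
    A.canonicalHeightAlg φ α = 0 := by
  obtain ⟨c, -, h⟩ := A.exists_tendsto_canonicalHeightAlg hd
  refine tendsto_nhds_unique (h α).1 ?_
  have hfin : (Set.range fun n : ℕ =>
      A.heightAlg (polyIter (φ.map (algebraMap K (AlgebraicClosure K))) n α)).Finite := by
    have := hα.image A.heightAlg
    rwa [← Set.range_comp] at this
  refine Tendsto.zero_mul_isBoundedUnder_le ?_ ?_
  · have hd' : (1 : ℝ) < φ.natDegree := by exact_mod_cast hd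
    exact (tendsto_pow_atTop_atTop_of_one_lt hd').inv_tendsto_atTop
  · obtain ⟨B, hB⟩ := hfin.isBounded.exists_norm_le
    exact isBoundedUnder_of ⟨B, fun n => hB _ ⟨n, rfl⟩⟩

end AdelicData

section Arithmetic

theorem IsUltrametricDist.norm_finset_sum_lt {L ι : Type*} [NormedField L] [IsUltrametricDist L]
    {s : Finset ι} {g : ι → L} {r : ℝ} (hr : 0 < r) (h : ∀ i ∈ s, ‖g i‖ < r) :
    ‖∑ i ∈ s, g i‖ < r := by
  classical
  induction s using Finset.induction_on with
  | empty => simpa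
  | insert a s ha ih =>
    rw [Finset.sum_insert ha]
    exact (IsUltrametricDist.norm_add_le_max _ _).trans_lt
      (max_lt (h a (by simp)) (ih fun i hi => h i (by simp [hi])))

theorem norm_eq_of_norm_sub_lt {L : Type*} [NormedField L] [IsUltrametricDist L] {x y : L}
    (h : ‖x - y‖ < ‖x‖) : ‖y‖ = ‖x‖ := by
  have h1 : ‖x + (y - x)‖ = max ‖x‖ ‖y - x‖ :=
    IsUltrametricDist.norm_add_eq_max_of_norm_ne_norm (by rw [norm_sub_rev y]; exact h.ne')
  rwa [add_sub_cancel, norm_sub_rev y, max_eq_left h.le] at h1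

variable {K : Type} [Field K] [NumberField K]

theorem exists_primitive_relation (y : K) : ∃ c : ℕ → ℤ, (∀ m : ℤ, (∀ i, m ∣ c i) → IsUnit m) ∧
    (∀ i, Module.finrank ℚ K < i → c i = 0) ∧
    ∑ i ∈ Finset.range (Module.finrank ℚ K + 1), (c i : K) * y ^ i = 0 := by
  have hy : IsIntegral ℚ y := Algebra.IsIntegral.isIntegral y
  set q := IsLocalization.integerNormalization (nonZeroDivisors ℤ) (minpoly ℚ y) with hq
  have hq0 : q ≠ 0 := by
    rw [hq, Ne, IsLocalization.integerNormalization_eq_zero_iff le_rfl]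
    exact minpoly.ne_zero hy
  have hqa : Polynomial.aeval y q = 0 :=
    IsLocalization.integerNormalization_aeval_eq_zero _ _ (minpoly.aeval ℚ y)
  have hdeg : q.primPart.natDegree ≤ Module.finrank ℚ K := by
    rw [Polynomial.natDegree_primPart]
    refine le_trans ?_ (minpoly.natDegree_le y)
    rw [Polynomial.natDegree_le_iff_coeff_eq_zero]
    intro N hN
    rw [← Polynomial.notMem_support_iff]
    intro h
    replace h := IsLocalization.integerNormalization_support _ _ h
    exact absurd (Polynomial.le_natDegree_of_mem_supp _ h) (by omega)
  refine ⟨q.primPart.coeff, fun m hm => ?_, fun i hi => ?_, ?_⟩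
  · exact q.isPrimitive_primPart m (Polynomial.C_dvd_iff_dvd_coeff _ _ |>.2 hm)
  · exact Polynomial.coeff_eq_zero_of_natDegree_lt (by omega)
  · have h := Polynomial.aeval_primPart_eq_zero hq0 hqa
    rw [Polynomial.aeval_eq_sum_range' (n := Module.finrank ℚ K + 1) (by omega)] at h
    simpa [zsmul_eq_mul] using h

theorem exists_int_relation {C : Type} [NormedField C] (ι : K →+* C) {m : ℕ} (hm1 : m ≠ 1) (y : K) :
    ∃ c : ℕ → ℤ, (∃ j, j ≤ Module.finrank ℚ K ∧ ¬ (m : ℤ) ∣ c j) ∧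
    ∑ i ∈ Finset.range (Module.finrank ℚ K + 1), (c i : C) * ι y ^ i = 0 := by
  obtain ⟨c, hc, hc0, hsum⟩ := exists_primitive_relation y
  refine ⟨c, ?_, by simpa using congrArg ι hsum⟩
  by_contra! h
  have := hc m fun i => by
    rcases le_or_gt i (Module.finrank ℚ K) with hi | hi
    · exact h i hi
    · simp [hc0 i hi]
  rw [Int.isUnit_iff_natAbs_eq] at this
  simp at this
  exact hm1 this

variable {C : Type} [NormedField C] [IsUltrametricDist C]

theorem exists_generator_of_norm_lt_one (C : Type) [NormedField C] [IsUltrametricDist C] :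
    ∃ m : ℕ, m ≠ 1 ∧ ‖(m : C)‖ < 1 ∧ ∀ n : ℤ, ¬ (m : ℤ) ∣ n → ‖(n : C)‖ = 1 := by
  classical
  by_cases H : ∃ m : ℕ, 0 < m ∧ ‖(m : C)‖ < 1
  · obtain ⟨hm0, hm1⟩ := Nat.find_spec H
    set m := Nat.find H with hm
    refine ⟨m, fun h => by simp [h] at hm1, hm1, fun n hn => ?_⟩
    have hr0 : 0 ≤ n % m := Int.emod_nonneg _ (by omega)
    have hr1 : n % m < m := Int.emod_lt_of_pos _ (by omega)
    have hr2 : n % m ≠ 0 := fun h => hn (Int.dvd_of_emod_eq_zero h)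
    obtain ⟨r, hr⟩ := Int.eq_ofNat_of_zero_le hr0
    have hrn : ‖(r : C)‖ = 1 := by
      refine le_antisymm (IsUltrametricDist.norm_natCast_le_one C r) ?_
      by_contra! h
      exact Nat.find_min H (m := r) (by omega) ⟨by omega, h⟩
    have hsub : (r : C) - (n : C) = -((m : C) * ((n / m : ℤ) : C)) := by
      have h1 : (m : ℤ) * (n / m) + r = n := by rw [← hr]; exact Int.mul_ediv_add_emod n m
      have h2 : (m : C) * ((n / m : ℤ) : C) + (r : C) = n := by exact_mod_cast congrArg _ h1
      rw [← h2]; ring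
    rw [← hrn]
    refine norm_eq_of_norm_sub_lt ?_
    rw [hsub, norm_neg, norm_mul, hrn]
    calc _ ≤ ‖(m : C)‖ * 1 := by
          gcongr; exact IsUltrametricDist.norm_intCast_le_one C _
      _ < 1 := by simpa
  · push Not at H
    refine ⟨0, by simp, by simp, fun n hn => ?_⟩
    refine le_antisymm (IsUltrametricDist.norm_intCast_le_one C _) ?_
    have hn0 : n ≠ 0 := fun h => hn (by simp [h])
    have := H n.natAbs (by omega)
    have h2 : ‖((n.natAbs : ℕ) : C)‖ = ‖(n : C)‖ := by
      rcases Int.natAbs_eq n with h | h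
      · conv_rhs => rw [h]
        simp
      · conv_rhs => rw [h]
        simp
    rwa [h2] at this

variable (ι : K →+* C) {m : ℕ}

theorem norm_intCast_le_of_dvd {n : ℤ} (h : (m : ℤ) ∣ n) :
    ‖(n : C)‖ ≤ ‖(m : C)‖ := by
  obtain ⟨k, rfl⟩ := h
  rw [Int.cast_mul, norm_mul, Int.cast_natCast]
  exact mul_le_of_le_one_right (norm_nonneg _) (IsUltrametricDist.norm_intCast_le_one C k)

theorem norm_pow_finrank_le (hm1 : m ≠ 1)
    (hm : ∀ n : ℤ, ¬ (m : ℤ) ∣ n → ‖(n : C)‖ = 1) {y : K} (hy : ‖ι y‖ < 1) :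
    ‖ι y‖ ^ Module.finrank ℚ K ≤ ‖(m : C)‖ := by
  classical
  by_contra! hlt
  set g := Module.finrank ℚ K with hg
  have hgpos : 0 < g := Module.finrank_pos
  have hy0 : 0 < ‖ι y‖ := by
    rcases (norm_nonneg (ι y)).eq_or_lt with h | h
    · rw [← h, zero_pow hgpos.ne'] at hlt
      exact absurd hlt (norm_nonneg _).not_gt
    · exact h
  obtain ⟨c, hex, hsum⟩ := exists_int_relation ι hm1 y
  obtain ⟨hjg, hj⟩ := Nat.find_spec hex
  have hmin : ∀ i < Nat.find hex, (m : ℤ) ∣ c i := fun i hi => by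
    by_contra h
    exact Nat.find_min hex hi ⟨hi.le.trans hjg, h⟩
  set j := Nat.find hex
  have hjr : j ∈ Finset.range (g + 1) := by simp; omega
  rw [← Finset.add_sum_erase _ _ hjr] at hsum
  have hjn : ‖(c j : C) * ι y ^ j‖ = ‖ι y‖ ^ j := by rw [norm_mul, norm_pow, hm _ hj, one_mul]
  have hrest : ‖∑ i ∈ (Finset.range (g + 1)).erase j, (c i : C) * ι y ^ i‖ < ‖ι y‖ ^ j := by
    refine IsUltrametricDist.norm_finset_sum_lt (by positivity) fun i hi => ?_
    rw [norm_mul, norm_pow]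
    rcases lt_or_gt_of_ne (Finset.ne_of_mem_erase hi) with hij | hij
    · calc ‖(c i : C)‖ * ‖ι y‖ ^ i ≤ ‖(m : C)‖ * 1 := by
            gcongr
            · exact norm_intCast_le_of_dvd (hmin i hij)
            · exact pow_le_one₀ hy0.le hy.le
        _ < ‖ι y‖ ^ g := by rwa [mul_one]
        _ ≤ ‖ι y‖ ^ j := pow_le_pow_of_le_one hy0.le hy.le hjg
    · calc ‖(c i : C)‖ * ‖ι y‖ ^ i ≤ 1 * ‖ι y‖ ^ i := by
            gcongr
            exact IsUltrametricDist.norm_intCast_le_one C _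
        _ < ‖ι y‖ ^ j := by
            rw [one_mul]; exact pow_lt_pow_right_of_lt_one₀ hy0 hy hij
  have heq := eq_neg_of_add_eq_zero_left hsum
  rw [← norm_neg, ← heq, hjn] at hrest
  exact lt_irrefl _ hrest

theorem exists_finite_residue_representatives [IsAlgClosed C] (hm1 : m ≠ 1) (hm0 : m ≠ 0)
    (hmlt : ‖(m : C)‖ < 1) (hm : ∀ n : ℤ, ¬ (m : ℤ) ∣ n → ‖(n : C)‖ = 1) :
    ∃ T : Set C, T.Finite ∧ ∀ y : K, ‖ι y‖ ≤ 1 → ∃ t ∈ T, ‖ι y - t‖ < 1 := by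
  classical
  set g := Module.finrank ℚ K with hg
  set F : (Fin (g + 1) → Fin m) → Polynomial C := fun c =>
    ∑ i : Fin (g + 1), Polynomial.monomial (i : ℕ) (((c i : ℕ) : ℤ) : C) with hF
  have hcoeff : ∀ c (i : Fin (g + 1)), (F c).coeff i = (((c i : ℕ) : ℤ) : C) := by
    intro c i
    simp only [hF, Polynomial.finsetSum_coeff, Polynomial.coeff_monomial]
    rw [Finset.sum_eq_single i]
    · simp
    · intro b _ hb
      rw [if_neg]
      exact fun h => hb (Fin.ext h)
    · simp
  have hcoeff' : ∀ c (i : ℕ), (F c).coeff i ≠ 0 → ‖(F c).coeff i‖ = 1 := by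
    intro c i hi
    have hig : i < g + 1 := by
      by_contra! h
      apply hi
      simp only [hF, Polynomial.finsetSum_coeff, Polynomial.coeff_monomial]
      refine Finset.sum_eq_zero fun b _ => ?_
      rw [if_neg]
      have := b.2
      omega
    have h1 := hcoeff c ⟨i, hig⟩
    simp only at h1
    rw [h1] at hi ⊢
    refine hm _ fun h => hi ?_
    have h2 := (c ⟨i, hig⟩).2
    have h3 : ((c ⟨i, hig⟩ : ℕ) : ℤ) = 0 := by
      refine Int.eq_zero_of_dvd_of_nonneg_of_lt (by omega) ?_ h
      exact_mod_cast h2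
    rw [h3, Int.cast_zero]
  refine ⟨⋃ c, {t | t ∈ (F c).roots}, Set.finite_iUnion fun c => ?_, fun y hy => ?_⟩
  · exact (F c).roots.finite_toSet
  obtain ⟨c, ⟨j, hjg, hj⟩, hsum⟩ := exists_int_relation ι hm1 y
  set r : Fin (g + 1) → Fin m := fun i => ⟨(c i % m).toNat, by
    have h1 := Int.emod_nonneg (c i) (b := m) (by omega)
    have h2 := Int.emod_lt_of_pos (c i) (b := m) (by omega)
    omega⟩ with hr
  have hrz : ∀ i : Fin (g + 1), (((r i : ℕ) : ℤ)) = c i % m := fun i =>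
    Int.toNat_of_nonneg (Int.emod_nonneg _ (by omega))
  have hF0 : F r ≠ 0 := by
    intro h
    have h1 := hcoeff r ⟨j, by omega⟩
    rw [h, Polynomial.coeff_zero, hrz] at h1
    have h2 := hm (c j % m) fun h => hj (by
      have := Int.mul_ediv_add_emod (c j) m
      rw [← this]
      exact dvd_add (dvd_mul_right _ _) h)
    rw [← h1] at h2
    simp at h2
  have hev : ‖(F r).eval (ι y)‖ < 1 := by
    have h1 : (F r).eval (ι y) = ∑ i : Fin (g + 1), ((c i % m : ℤ) : C) * ι y ^ (i : ℕ) := by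
      simp only [hF, Polynomial.eval_finsetSum, Polynomial.eval_monomial, hrz]
    rw [Finset.sum_range] at hsum
    rw [h1, ← sub_zero (∑ i : Fin (g + 1), _), ← hsum, ← Finset.sum_sub_distrib]
    refine IsUltrametricDist.norm_finset_sum_lt one_pos fun i _ => ?_
    rw [← sub_mul, norm_mul, norm_pow, ← Int.cast_sub]
    refine (mul_le_of_le_one_right (norm_nonneg _) (pow_le_one₀ (norm_nonneg _) hy)).trans_lt ?_
    refine (norm_intCast_le_of_dvd ?_).trans_lt hmlt
    rw [Int.emod_def, sub_sub_cancel_left]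
    exact (dvd_mul_right _ _).neg_right
  have hlc : ‖(F r).leadingCoeff‖ = 1 :=
    hcoeff' r _ (Polynomial.leadingCoeff_ne_zero.2 hF0)
  rw [(IsAlgClosed.splits (F r)).eval_eq_prod_roots, norm_mul, hlc, one_mul] at hev
  by_contra! hcon
  refine hev.not_ge ?_
  have hall : ∀ t ∈ (F r).roots, 1 ≤ ‖ι y - t‖ := fun t ht => hcon t (Set.mem_iUnion.2 ⟨r, ht⟩)
  generalize (F r).roots = s at hall
  induction s using Multiset.induction_on with
  | empty => simp
  | cons a s ih =>
    rw [Multiset.map_cons, Multiset.prod_cons, norm_mul]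
    exact one_le_mul_of_one_le_of_one_le (hall a (by simp))
      (ih fun t ht => hall t (by simp [ht]))

end Arithmetic

theorem IsUltrametricDist.norm_sub_le_max_norm {C : Type*} [NormedField C] [IsUltrametricDist C]
    (x y : C) : ‖x - y‖ ≤ max ‖x‖ ‖y‖ := by
  have := IsUltrametricDist.norm_add_le_max x (-y)
  rwa [norm_neg, ← sub_eq_add_neg] at this

section LocalExtensionBounds

variable {K : Type} [Field K]
  {C : Type} [NormedField C] {ι : K →+* C} {Kv E : Subfield C}

theorem exists_norm_sub_lt_of_mem (hKv : (Kv : Set C) = closure (Set.range ι)) {y : C}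
    (hy : y ∈ Kv) {ε : ℝ} (hε : 0 < ε) : ∃ k : K, ‖y - ι k‖ < ε := by
  have : y ∈ closure (Set.range ι) := by rw [← hKv]; exact hy
  obtain ⟨_, ⟨k, rfl⟩, hk⟩ := Metric.mem_closure_iff.1 this ε hε
  exact ⟨k, by rwa [← dist_eq_norm]⟩

variable [IsUltrametricDist C]

theorem exists_norm_eq_of_mem (hKv : (Kv : Set C) = closure (Set.range ι)) {y : C}
    (hy : y ∈ Kv) (hy0 : y ≠ 0) : ∃ k : K, k ≠ 0 ∧ ‖ι k‖ = ‖y‖ := by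
  obtain ⟨k, hk⟩ := exists_norm_sub_lt_of_mem hKv hy (norm_pos_iff.2 hy0)
  have h := norm_eq_of_norm_sub_lt hk
  refine ⟨k, ?_, h⟩
  rintro rfl
  rw [map_zero, norm_zero] at h
  exact hy0 (norm_eq_zero.1 h.symm)

theorem exists_norm_pow_eq_of_ramIndexLe (hKv : (Kv : Set C) = closure (Set.range ι)) {e : ℕ}
    (hE : RamIndexLe Kv E e) {x : C} (hx : x ∈ E) (hx0 : x ≠ 0) :
    ∃ j, 0 < j ∧ j ≤ e ∧ ∃ k : K, k ≠ 0 ∧ ‖x‖ ^ j = ‖ι k‖ := by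
  obtain ⟨t, ht, hcov⟩ := hE
  have h1 : ∀ i : Fin (e + 1), ∃ l : Fin e, ∃ y ∈ Kv, y ≠ 0 ∧ ‖x ^ (i : ℕ)‖ = ‖t l‖ * ‖y‖ :=
    fun i => hcov _ (pow_mem hx _) (pow_ne_zero _ hx0)
  choose l y hyK hy0 hxy using h1
  obtain ⟨i, i', hii, hl⟩ := Fintype.exists_ne_map_eq_of_card_lt l (by simp)
  wlog hlt : i < i' generalizing i i'
  · exact this i' i hii.symm hl.symm (lt_of_le_of_ne (not_lt.1 hlt) hii.symm)
  have hlt' : (i : ℕ) < i' := hlt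
  obtain ⟨k, hk0, hk⟩ := exists_norm_eq_of_mem hKv (div_mem (hyK i') (hyK i))
    (div_ne_zero (hy0 i') (hy0 i))
  refine ⟨i' - i, by omega, by omega, k, hk0, ?_⟩
  have e1 := hxy i
  have e2 := hxy i'
  rw [norm_pow] at e1 e2
  have hx1 : ‖x‖ ^ (i : ℕ) ≠ 0 := pow_ne_zero _ (norm_ne_zero_iff.2 hx0)
  have ht0 : ‖t (l i)‖ ≠ 0 := norm_ne_zero_iff.2 (ht _).2
  have hy1 : ‖y i‖ ≠ 0 := norm_ne_zero_iff.2 (hy0 i)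
  have e3 : ‖x‖ ^ (i' - i : ℕ) * ‖x‖ ^ (i : ℕ) = ‖x‖ ^ (i' : ℕ) := by
    rw [← pow_add]; congr 1; omega
  rw [hk, norm_div]
  rw [e1, e2, ← hl] at e3
  have e4 : ‖x‖ ^ (i' - i : ℕ) * ‖y i‖ = ‖y i'‖ := by
    apply mul_left_cancel₀ ht0
    rw [← e3]; ring
  rw [eq_div_iff hy1, e4]

theorem norm_pow_sub_one_lt {x : C} (hx : ‖x - 1‖ < 1) (n : ℕ) : ‖x ^ n - 1‖ < 1 := by
  have hx1 : ‖x‖ = 1 := by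
    have := norm_eq_of_norm_sub_lt (x := (1 : C)) (y := x) (by rwa [norm_sub_rev, norm_one])
    rwa [norm_one] at this
  induction n with
  | zero => simp
  | succ n ih =>
    have : x ^ (n + 1) - 1 = (x ^ n - 1) * x + (x - 1) := by ring
    rw [this]
    refine (IsUltrametricDist.norm_add_le_max _ _).trans_lt (max_lt ?_ hx)
    rwa [norm_mul, hx1, mul_one]

theorem exists_uniform_norm_pow_sub_lt (hKv : (Kv : Set C) = closure (Set.range ι)) {T : Set C}
    (hT : T.Finite) (hTK : ∀ y : K, ‖ι y‖ ≤ 1 → ∃ t ∈ T, ‖ι y - t‖ < 1) (f : ℕ) :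
    ∃ Q : ℕ, 2 ≤ Q ∧ ∀ E : Subfield C, ResDegreeLe Kv E f → ∀ x ∈ E, ‖x‖ ≤ 1 →
      ‖x ^ Q - x‖ < 1 := by
  classical
  have := hT.to_subtype
  have := Fintype.ofFinite T
  set M := Fintype.card (Fin f → T) with hM
  refine ⟨M.factorial + 1, by have := M.factorial_pos; omega, fun E hE x hx hx1 => ?_⟩
  obtain ⟨s, hs, hcov⟩ := hE
  have hKvT : ∀ y ∈ Kv, ‖y‖ ≤ 1 → ∃ t : T, ‖y - t‖ < 1 := by
    intro y hy hy1
    obtain ⟨k, hk⟩ := exists_norm_sub_lt_of_mem hKv hy one_pos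
    have hk1 : ‖ι k‖ ≤ 1 := by
      have : ι k = y - (y - ι k) := by ring
      rw [this]
      exact (IsUltrametricDist.norm_sub_le_max_norm _ _).trans (max_le hy1 hk.le)
    obtain ⟨t, ht, hkt⟩ := hTK k hk1
    refine ⟨⟨t, ht⟩, ?_⟩
    have : y - t = (y - ι k) + (ι k - t) := by ring
    simp only [this]
    exact (IsUltrametricDist.norm_add_le_max _ _).trans_lt (max_lt hk hkt)
  rcases hx1.lt_or_eq with hlt | heq
  · refine (IsUltrametricDist.norm_sub_le_max_norm _ _).trans_lt (max_lt ?_ hlt)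
    rw [norm_pow]
    exact pow_lt_one₀ (norm_nonneg _) hlt (by omega)
  have hcls : ∀ i : ℕ, ∃ τ : Fin f → T, ‖x ^ i - ∑ l, (τ l : C) * s l‖ < 1 := by
    intro i
    obtain ⟨a, ha, hxa⟩ := hcov (x ^ i) (pow_mem hx i) (by rw [norm_pow, heq, one_pow])
    choose τ hτ using fun l => hKvT (a l) (ha l).1 (ha l).2
    refine ⟨τ, ?_⟩
    have : x ^ i - ∑ l, (τ l : C) * s l =
        (x ^ i - ∑ l, a l * s l) + ∑ l, (a l - τ l) * s l := by
      simp only [sub_mul, Finset.sum_sub_distrib]; ring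
    rw [this]
    refine (IsUltrametricDist.norm_add_le_max _ _).trans_lt (max_lt hxa ?_)
    refine IsUltrametricDist.norm_finset_sum_lt one_pos fun l _ => ?_
    rw [norm_mul]
    exact (mul_le_of_le_one_right (norm_nonneg _) (hs l).2).trans_lt (hτ l)
  choose τ hτ using hcls
  obtain ⟨i, i', hii, hτi⟩ := Fintype.exists_ne_map_eq_of_card_lt
    (fun i : Fin (M + 1) => τ i) (by rw [Fintype.card_fin, ← hM]; omega)
  wlog hlt : i < i' generalizing i i'
  · exact this i' i hii.symm hτi.symm (lt_of_le_of_ne (not_lt.1 hlt) hii.symm)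
  have hlt' : (i : ℕ) < i' := hlt
  have h1 : ‖x ^ (i' : ℕ) - x ^ (i : ℕ)‖ < 1 := by
    have : x ^ (i' : ℕ) - x ^ (i : ℕ) = (x ^ (i' : ℕ) - ∑ l, (τ i' l : C) * s l) -
        (x ^ (i : ℕ) - ∑ l, (τ i l : C) * s l) := by
      rw [hτi]; ring
    rw [this]
    exact (IsUltrametricDist.norm_sub_le_max_norm _ _).trans_lt (max_lt (hτ _) (hτ _))
  have h2 : ‖x ^ (i' - i : ℕ) - 1‖ < 1 := by
    have : x ^ (i' : ℕ) - x ^ (i : ℕ) = (x ^ (i' - i : ℕ) - 1) * x ^ (i : ℕ) := by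
      rw [sub_mul, ← pow_add, one_mul]; congr 2; omega
    rwa [this, norm_mul, norm_pow, heq, one_pow, mul_one] at h1
  obtain ⟨q, hq⟩ : (i' - i : ℕ) ∣ M.factorial :=
    Nat.dvd_factorial (by omega) (by omega)
  have h3 := norm_pow_sub_one_lt h2 q
  rw [← pow_mul, ← hq] at h3
  have : x ^ (M.factorial + 1) - x = (x ^ M.factorial - 1) * x := by ring
  rwa [this, norm_mul, heq, mul_one]

/-- If the residue field and value group are those of a `p`-adic place, then the polynomial
`X ^ Q - X` is uniformly small on the integral elements of all the extensions of type `(e, f)`. -/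
theorem exists_uniform_contraction [NumberField K] [IsAlgClosed C]
    (hKv : (Kv : Set C) = closure (Set.range ι)) {m : ℕ} (hm1 : m ≠ 1) (hm0 : m ≠ 0)
    (hmlt : ‖(m : C)‖ < 1) (hm : ∀ n : ℤ, ¬ (m : ℤ) ∣ n → ‖(n : C)‖ = 1) {e : ℕ} (he : 0 < e)
    (f : ℕ) :
    ∃ (Q : ℕ) (ρ : ℝ), 2 ≤ Q ∧ 0 < ρ ∧ ρ < 1 ∧ ∀ E : Subfield C, RamIndexLe Kv E e →
      ResDegreeLe Kv E f → ∀ x ∈ E, (‖x‖ ≤ 1 → ‖x ^ Q - x‖ ≤ ρ) ∧ (1 < ‖x‖ → 1 ≤ ρ * ‖x‖) := by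
  obtain ⟨T, hT, hTK⟩ := exists_finite_residue_representatives ι hm1 hm0 hmlt hm
  obtain ⟨Q, hQ, hQE⟩ := exists_uniform_norm_pow_sub_lt hKv hT hTK f
  have : CharZero C := charZero_of_injective_ringHom ι.injective
  set g := Module.finrank ℚ K
  have hg : 0 < g := Module.finrank_pos
  have hp : 0 < ‖(m : C)‖ := norm_pos_iff.2 (Nat.cast_ne_zero.2 hm0)
  have heg : (0 : ℝ) < (e * g : ℕ) := by exact_mod_cast Nat.mul_pos he hg
  set ρ : ℝ := ‖(m : C)‖ ^ (((e * g : ℕ) : ℝ)⁻¹) with hρ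
  have hρ0 : 0 < ρ := Real.rpow_pos_of_pos hp _
  have hρpow : ρ ^ (e * g) = ‖(m : C)‖ := Real.rpow_inv_natCast_pow hp.le (by positivity)
  have hρ1 : ρ < 1 := Real.rpow_lt_one hp.le hmlt (by positivity)
  have hgap : ∀ E : Subfield C, RamIndexLe Kv E e → ∀ x ∈ E, ‖x‖ < 1 → ‖x‖ ≤ ρ := by
    intro E hE x hx hx1
    rcases eq_or_ne x 0 with rfl | hx0
    · simpa using hρ0.le
    obtain ⟨j, hj0, hje, k, hk0, hk⟩ := exists_norm_pow_eq_of_ramIndexLe hKv hE hx hx0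
    have h1 : ‖ι k‖ < 1 := by rw [← hk]; exact pow_lt_one₀ (norm_nonneg _) hx1 hj0.ne'
    have h2 := norm_pow_finrank_le ι hm1 hm h1
    rw [← hk, ← pow_mul] at h2
    refine le_of_pow_le_pow_left₀ (n := e * g) (by positivity) hρ0.le ?_
    rw [hρpow]
    refine le_trans ?_ h2
    exact pow_le_pow_of_le_one (norm_nonneg _) hx1.le (Nat.mul_le_mul_right _ hje)
  refine ⟨Q, ρ, hQ, hρ0, hρ1, fun E hram hres x hx => ⟨fun hx1 => ?_, fun hx1 => ?_⟩⟩
  · exact hgap E hram _ (sub_mem (pow_mem hx _) hx) (hQE E hres x hx hx1)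
  · have h := hgap E hram _ (inv_mem hx) (by rw [norm_inv]; exact inv_lt_one_of_one_lt₀ hx1)
    rw [norm_inv, inv_le_iff_one_le_mul₀ (by linarith)] at h
    linarith

/-- If the absolute value is trivial on `K`, elements of extensions of residue degree at most `f`
satisfy a polynomial of degree at most `f` over `K`. -/
theorem exists_polynomial_of_trivial [NumberField K]
    (hKv : (Kv : Set C) = closure (Set.range ι))
    (hm : ∀ n : ℤ, ¬ (0 : ℤ) ∣ n → ‖(n : C)‖ = 1) {e f : ℕ} (hKvE : Kv ≤ E)
    (hram : RamIndexLe Kv E e) (hres : ResDegreeLe Kv E f) {x : C} (hx : x ∈ E) :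
    ∃ p : Polynomial K, p ≠ 0 ∧ p.natDegree ≤ f ∧ p.eval₂ ι x = 0 := by
  have hg : 0 < Module.finrank ℚ K := Module.finrank_pos
  have hlt : ∀ k : K, k ≠ 0 → 1 ≤ ‖ι k‖ := by
    intro k hk
    by_contra! h
    have := norm_pow_finrank_le ι (m := 0) zero_ne_one (by simpa using hm) h
    simp only [Nat.cast_zero, norm_zero] at this
    have h0 : 0 < ‖ι k‖ := norm_pos_iff.2 ((map_ne_zero _).2 hk)
    exact (pow_pos h0 _).not_ge this
  have hone : ∀ k : K, k ≠ 0 → ‖ι k‖ = 1 := by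
    intro k hk
    refine le_antisymm ?_ (hlt k hk)
    have := hlt k⁻¹ (inv_ne_zero hk)
    rw [map_inv₀, norm_inv] at this
    exact (one_le_inv₀ (norm_pos_iff.2 ((map_ne_zero _).2 hk))).1 this
  have hEone : ∀ z ∈ E, z ≠ 0 → ‖z‖ = 1 := by
    intro z hz hz0
    obtain ⟨j, hj0, -, k, hk0, hk⟩ := exists_norm_pow_eq_of_ramIndexLe hKv hram hz hz0
    rw [hone k hk0] at hk
    exact (pow_eq_one_iff_of_nonneg (norm_nonneg _) hj0.ne').1 hk
  have hEzero : ∀ z ∈ E, ‖z‖ < 1 → z = 0 := fun z hz h => by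
    by_contra h0
    exact h.ne (hEone z hz h0)
  have hle : ∀ z ∈ E, ‖z‖ ≤ 1 := fun z hz => by
    rcases eq_or_ne z 0 with rfl | h
    · simp
    · exact (hEone z hz h).le
  have hKvK : ∀ y ∈ Kv, ∃ k : K, ι k = y := by
    intro y hy
    obtain ⟨k, hk⟩ := exists_norm_sub_lt_of_mem hKv hy one_pos
    have hkE : ι k ∈ Kv := by
      have : ι k ∈ (Kv : Set C) := by rw [hKv]; exact subset_closure ⟨k, rfl⟩
      exact this
    exact ⟨k, (sub_eq_zero.1 (hEzero _ (hKvE (sub_mem hy hkE)) hk)).symm⟩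
  obtain ⟨s, hs, hcov⟩ := hres
  have hrep : ∀ i : Fin (f + 1), ∃ b : Fin f → K, x ^ (i : ℕ) = ∑ l, ι (b l) * s l := by
    intro i
    obtain ⟨a, ha, hxa⟩ := hcov _ (pow_mem hx i) (hle _ (pow_mem hx i))
    choose b hb using fun l => hKvK _ (ha l).1
    refine ⟨b, ?_⟩
    simp only [hb]
    refine sub_eq_zero.1 (hEzero _ (sub_mem (pow_mem hx _) (sum_mem fun l _ => ?_)) hxa)
    exact mul_mem (hKvE (ha l).1) (hs l).1
  choose b hb using hrep
  have hdep : ¬ LinearIndependent K b := by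
    intro h
    have := h.fintype_card_le_finrank
    simp at this
  obtain ⟨c, hc, i, hi⟩ := Fintype.not_linearIndependent_iff.1 hdep
  refine ⟨∑ i : Fin (f + 1), Polynomial.monomial (i : ℕ) (c i), ?_, ?_, ?_⟩
  · intro h
    apply hi
    have h1 := congrArg (fun p => Polynomial.coeff p i) h
    simp only [Polynomial.finsetSum_coeff, Polynomial.coeff_monomial, Polynomial.coeff_zero] at h1
    rw [Finset.sum_eq_single i] at h1
    · simpa using h1
    · intro j _ hj
      rw [if_neg]
      exact fun h => hj (Fin.ext h)
    · simp
  · refine Polynomial.natDegree_sum_le_of_forall_le _ _ fun j _ => ?_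
    exact (Polynomial.natDegree_monomial_le _).trans (by omega)
  · simp only [Polynomial.eval₂_finsetSum, Polynomial.eval₂_monomial, hb, Finset.mul_sum]
    rw [Finset.sum_comm]
    refine Finset.sum_eq_zero fun l _ => ?_
    have h1 := congrArg ι (congrFun hc l)
    simp only [Finset.sum_apply, Pi.smul_apply, smul_eq_mul, map_sum, map_mul, Pi.zero_apply,
      map_zero] at h1
    simp only [← mul_assoc, ← Finset.sum_mul, h1, zero_mul]

end LocalExtensionBounds

section DeterminantBounds

variable {L : Type*} [NormedField L] {n : ℕ}

theorem norm_det_term_le {M : Matrix (Fin n) (Fin n) L} {a b : Fin n → ℝ}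
    (h : ∀ i j, ‖M i j‖ ≤ Real.exp (a i + b j)) (σ : Equiv.Perm (Fin n)) :
    ‖Equiv.Perm.sign σ • ∏ i, M (σ i) i‖ ≤ Real.exp (∑ i, a i + ∑ j, b j) := by
  have h1 : ‖Equiv.Perm.sign σ • ∏ i, M (σ i) i‖ = ∏ i, ‖M (σ i) i‖ := by
    rw [← norm_prod]
    rcases Int.units_eq_one_or (Equiv.Perm.sign σ) with h | h <;> simp [h]
  rw [h1, ← Equiv.sum_comp σ a, ← Finset.sum_add_distrib, Real.exp_sum]
  exact Finset.prod_le_prod (fun _ _ => norm_nonneg _) fun i _ => h _ _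

theorem norm_det_le_factorial_mul_exp {M : Matrix (Fin n) (Fin n) L} {a b : Fin n → ℝ}
    (h : ∀ i j, ‖M i j‖ ≤ Real.exp (a i + b j)) :
    ‖M.det‖ ≤ n.factorial * Real.exp (∑ i, a i + ∑ j, b j) := by
  rw [Matrix.det_apply]
  refine (norm_sum_le_of_le _ fun σ _ => norm_det_term_le h σ).trans_eq ?_
  simp [Fintype.card_perm]

theorem norm_det_le_exp [IsUltrametricDist L] {M : Matrix (Fin n) (Fin n) L} {a b : Fin n → ℝ}
    (h : ∀ i j, ‖M i j‖ ≤ Real.exp (a i + b j)) :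
    ‖M.det‖ ≤ Real.exp (∑ i, a i + ∑ j, b j) := by
  rw [Matrix.det_apply]
  exact IsUltrametricDist.norm_sum_le_of_forall_le_of_nonneg (Real.exp_pos _).le
    fun σ _ => norm_det_term_le h σ

theorem pow_norm_le_exp_mul_logPlus (x : L) (k : ℕ) :
    ‖x‖ ^ k ≤ Real.exp (k * logPlus ‖x‖) := by
  rw [Real.exp_nat_mul, exp_logPlus]
  exact pow_le_pow_left₀ (norm_nonneg _) (le_max_left _ _) _

/-- The matrix with entries `y i ^ (j % D) * w i ^ (j / D)`. -/
def mixedPowerMatrix {R : Type*} [CommRing R] {n : ℕ} (D : ℕ) (y w : Fin n → R) :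
    Matrix (Fin n) (Fin n) R :=
  Matrix.of fun i j => y i ^ ((j : ℕ) % D) * w i ^ ((j : ℕ) / D)

theorem norm_mixedPowerMatrix_le {D : ℕ} (hD : 0 < D) (y w : Fin n → L) (i j : Fin n) :
    ‖mixedPowerMatrix D y w i j‖ ≤
      Real.exp ((D * logPlus ‖y i‖ + n / D * logPlus ‖w i‖) + (fun _ => 0 : Fin n → ℝ) j) := by
  simp only [mixedPowerMatrix, Matrix.of_apply, norm_mul, norm_pow, add_zero]
  rw [Real.exp_add]
  refine mul_le_mul ((pow_norm_le_exp_mul_logPlus _ _).trans (Real.exp_le_exp.2 ?_))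
    ((pow_norm_le_exp_mul_logPlus _ _).trans (Real.exp_le_exp.2 ?_)) (by positivity)
    (Real.exp_pos _).le
  · refine mul_le_mul_of_nonneg_right ?_ (logPlus_nonneg _)
    exact_mod_cast (Nat.mod_lt _ hD).le
  · refine mul_le_mul_of_nonneg_right (Nat.cast_div_le.trans ?_) (logPlus_nonneg _)
    gcongr
    exact j.2.le

theorem log_norm_det_mixedPowerMatrix_le_of_ultrametric [IsUltrametricDist L] {D : ℕ}
    (hD : 0 < D) {y w : Fin n → L} (h0 : (mixedPowerMatrix D y w).det ≠ 0) :
    Real.log ‖(mixedPowerMatrix D y w).det‖ ≤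
      ∑ i, (D * logPlus ‖y i‖ + n / D * logPlus ‖w i‖) := by
  rw [Real.log_le_iff_le_exp (norm_pos_iff.2 h0)]
  simpa using norm_det_le_exp (norm_mixedPowerMatrix_le hD y w)

theorem log_norm_det_mixedPowerMatrix_le {D : ℕ}
    (hD : 0 < D) {y w : Fin n → L} (h0 : (mixedPowerMatrix D y w).det ≠ 0) :
    Real.log ‖(mixedPowerMatrix D y w).det‖ ≤
      n * Real.log n + ∑ i, (D * logPlus ‖y i‖ + n / D * logPlus ‖w i‖) := by
  have h := norm_det_le_factorial_mul_exp (norm_mixedPowerMatrix_le hD y w)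
  have hf : (0 : ℝ) < n.factorial := by exact_mod_cast n.factorial_pos
  refine (Real.log_le_log (norm_pos_iff.2 h0) h).trans ?_
  rw [Real.log_mul hf.ne' (Real.exp_pos _).ne', Real.log_exp]
  have h1 : Real.log n.factorial ≤ n * Real.log n := by
    rw [← Real.log_pow]
    exact Real.log_le_log hf (by exact_mod_cast n.factorial_le_pow)
  simpa using h1

open Polynomial in
theorem det_mixedPowerMatrix_eval {R : Type*} [CommRing R] [IsDomain R] {n : ℕ} (p : R[X])
    (hp : p ≠ 0) (z : Fin n → R) :
    (mixedPowerMatrix p.natDegree z fun i => p.eval (z i)).det =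
      (Matrix.vandermonde z).det * ∏ j : Fin n, p.leadingCoeff ^ ((j : ℕ) / p.natDegree) := by
  set P : Fin n → R[X] := fun j => X ^ ((j : ℕ) % p.natDegree) * p ^ ((j : ℕ) / p.natDegree)
    with hP
  have hdeg : ∀ j, (P j).natDegree = j := fun j => by
    rw [hP]
    simp only
    rw [natDegree_mul (pow_ne_zero _ X_ne_zero) (pow_ne_zero _ hp), natDegree_X_pow,
      natDegree_pow, Nat.mod_add_div']
  have hlead : ∀ j, (P j).coeff j = p.leadingCoeff ^ ((j : ℕ) / p.natDegree) := fun j => by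
    conv_lhs => rw [← hdeg j]
    rw [coeff_natDegree, hP]
    simp
  have h := Matrix.eval_matrixOfPolynomials_eq_vandermonde_mul_matrixOfPolynomials z P
    fun j => (hdeg j).le
  have h2 : mixedPowerMatrix p.natDegree z (fun i => p.eval (z i)) =
      Matrix.of fun i j => (P j).eval (z i) := by
    ext i j
    simp [mixedPowerMatrix, hP]
  rw [h2, h, Matrix.det_mul, Matrix.det_of_isUpperTriangular
    (Matrix.matrixOfPolynomials_blockTriangular P fun j => (hdeg j).le)]
  simp only [Matrix.of_apply, hlead]

theorem log_norm_det_vandermonde_le [IsUltrametricDist L] {Q : ℕ} (hQ : 2 ≤ Q) {ρ : ℝ}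
    (hρ0 : 0 < ρ) {y : Fin n → L} (hy : Function.Injective y)
    (h : ∀ i, (‖y i‖ ≤ 1 → ‖y i ^ Q - y i‖ ≤ ρ) ∧ (1 < ‖y i‖ → 1 ≤ ρ * ‖y i‖)) :
    Real.log ‖(Matrix.vandermonde y).det‖ ≤
      Real.log ρ * ∑ j ∈ Finset.range n, ((j / Q : ℕ) : ℝ) + ∑ i, 2 * n * logPlus ‖y i‖ := by
  open Polynomial in
  set p : L[X] := X ^ Q - X with hp
  have hdeg : p.natDegree = Q := by
    rw [hp, natDegree_sub_eq_left_of_natDegree_lt] <;> simp; omega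
  have hmon : p.leadingCoeff = 1 := by
    refine (monic_X_pow_sub ?_)
    rw [degree_X]; exact_mod_cast (by omega : 1 < Q)
  have hdet := det_mixedPowerMatrix_eval p (by rintro h0; simp [h0] at hmon) y
  simp only [hmon, one_pow, Finset.prod_const_one, mul_one, hdeg] at hdet
  rw [← hdet, Real.log_le_iff_le_exp (norm_pos_iff.2 (by
    rw [hdet]; exact Matrix.det_vandermonde_ne_zero_iff.2 hy))]
  have hb : ∀ i j, ‖mixedPowerMatrix Q y (fun i => p.eval (y i)) i j‖ ≤
      Real.exp (2 * n * logPlus ‖y i‖ +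
        (fun j : Fin n => Real.log ρ * (((j : ℕ) / Q : ℕ) : ℝ)) j) := by
    intro i j
    have hexp : Real.exp (Real.log ρ * (((j : ℕ) / Q : ℕ) : ℝ)) = ρ ^ ((j : ℕ) / Q) := by
      rw [mul_comm, Real.exp_nat_mul, Real.exp_log hρ0]
    have hpe : p.eval (y i) = y i ^ Q - y i := by simp [hp]
    simp only [mixedPowerMatrix, Matrix.of_apply, norm_mul, norm_pow, hpe]
    rw [Real.exp_add, hexp]
    rcases le_or_gt ‖y i‖ 1 with hle | hgt
    · rw [logPlus_eq_zero hle, mul_zero, Real.exp_zero]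
      exact mul_le_mul (pow_le_one₀ (norm_nonneg _) hle)
        (pow_le_pow_left₀ (norm_nonneg _) ((h i).1 hle) _) (by positivity) zero_le_one
    · have h1 : ‖y i ^ Q - y i‖ ≤ ‖y i‖ ^ Q := by
        refine (IsUltrametricDist.norm_sub_le_max_norm _ _).trans (max_le (norm_pow _ _).le ?_)
        exact le_self_pow₀ hgt.le (by omega)
      have h2 : Real.exp (2 * n * logPlus ‖y i‖) = ‖y i‖ ^ (2 * n) := by
        rw [logPlus_eq_log hgt.le, show (2 * n : ℝ) = ((2 * n : ℕ) : ℝ) by push_cast; rfl,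
          Real.exp_nat_mul, Real.exp_log (by linarith)]
      rw [h2]
      have hj := j.2
      calc ‖y i‖ ^ ((j : ℕ) % Q) * ‖y i ^ Q - y i‖ ^ ((j : ℕ) / Q)
          ≤ ‖y i‖ ^ ((j : ℕ) % Q) * (‖y i‖ ^ Q) ^ ((j : ℕ) / Q) := by gcongr
        _ = ‖y i‖ ^ (j : ℕ) * 1 := by rw [← pow_mul, ← pow_add, Nat.mod_add_div, mul_one]
        _ ≤ ‖y i‖ ^ (j : ℕ) * (ρ * ‖y i‖) ^ ((j : ℕ) / Q) := by
            gcongr; exact one_le_pow₀ ((h i).2 hgt)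
        _ = ‖y i‖ ^ ((j : ℕ) + (j : ℕ) / Q) * ρ ^ ((j : ℕ) / Q) := by
            rw [mul_pow, pow_add]; ring
        _ ≤ ‖y i‖ ^ (2 * n) * ρ ^ ((j : ℕ) / Q) := by
            gcongr
            · exact hgt.le
            · have := Nat.div_le_self (j : ℕ) Q
              omega
  refine (norm_det_le_exp hb).trans_eq ?_
  rw [add_comm, ← Finset.mul_sum, Finset.sum_range]

end DeterminantBounds

section SquaredDeterminant

theorem RingHom.map_det_mixedPowerMatrix {R S : Type*} [CommRing R] [CommRing S] (g : R →+* S)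
    {n : ℕ} (D : ℕ) (y w : Fin n → R) :
    g (mixedPowerMatrix D y w).det =
      (mixedPowerMatrix D (fun i => g (y i)) fun i => g (w i)).det := by
  rw [RingHom.map_det]
  congr 1
  ext i j
  simp [mixedPowerMatrix]

theorem det_mixedPowerMatrix_comp_perm_sq {R : Type*} [CommRing R] {n : ℕ} (D : ℕ)
    (y w : Fin n → R) (σ : Equiv.Perm (Fin n)) :
    (mixedPowerMatrix D (fun i => y (σ i)) fun i => w (σ i)).det ^ 2 =
      (mixedPowerMatrix D y w).det ^ 2 := by
  have : mixedPowerMatrix D (fun i => y (σ i)) (fun i => w (σ i)) =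
      (mixedPowerMatrix D y w).submatrix σ id := rfl
  rw [this, Matrix.det_permute, mul_pow]
  rcases Int.units_eq_one_or (Equiv.Perm.sign σ) with h | h <;> simp [h]

theorem exists_algebraMap_eq_det_mixedPowerMatrix_sq {K : Type} [Field K] [CharZero K]
    {α : AlgebraicClosure K} {n : ℕ} (z : Fin n ≃ galFinset α) (p : Polynomial K) (D : ℕ) :
    ∃ x : K, algebraMap K (AlgebraicClosure K) x =
      (mixedPowerMatrix D (fun i => (z i : AlgebraicClosure K)) fun i =>
        (p.map (algebraMap K (AlgebraicClosure K))).eval (z i : AlgebraicClosure K)).det ^ 2 := by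
  rw [← Set.mem_range, InfiniteGalois.mem_range_algebraMap_iff_fixed]
  intro σ
  have hmem : ∀ w : galFinset α, σ w ∈ galFinset α := fun w =>
    mem_galFinset.2 (map_mem_galOrbit (mem_galFinset.1 w.2) σ)
  have hinj : Function.Injective fun w : galFinset α => (⟨σ w, hmem w⟩ : galFinset α) := by
    intro a b hab
    exact Subtype.ext (σ.injective (congrArg Subtype.val hab))
  let π : Equiv.Perm (galFinset α) := Equiv.ofBijective _ (Finite.injective_iff_bijective.1 hinj)
  let τ : Equiv.Perm (Fin n) := (z.trans π).trans z.symm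
  have hτ : ∀ i, σ (z i : AlgebraicClosure K) = z (τ i) := fun i => by
    simp [τ, π]
  rw [map_pow]
  have h1 := RingHom.map_det_mixedPowerMatrix (σ : AlgebraicClosure K →+* AlgebraicClosure K) D
    (fun i => (z i : AlgebraicClosure K)) fun i =>
        (p.map (algebraMap K (AlgebraicClosure K))).eval (z i : AlgebraicClosure K)
  simp only [RingHom.coe_coe, map_eval_map, hτ] at h1
  rw [h1]
  exact det_mixedPowerMatrix_comp_perm_sq D (fun i => (z i : AlgebraicClosure K)) (fun i =>
        (p.map (algebraMap K (AlgebraicClosure K))).eval (z i : AlgebraicClosure K)) τ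

end SquaredDeterminant

namespace AdelicData

variable {K : Type} [Field K] (A : AdelicData K)

open scoped Classical in
theorem mul_sum_div_le [CharZero K] {p : Polynomial K} (hp : 0 < p.natDegree) {v₀ : A.V}
    (hu : IsUltrametricDist (A.C v₀).carrier) (hlead : ‖A.embK v₀ p.leadingCoeff‖ = 1)
    (hgood : ∀ z : AlgebraicClosure K,
      logPlus ‖A.emb v₀ ((p.map (algebraMap K (AlgebraicClosure K))).eval z)‖ =
        p.natDegree * logPlus ‖A.emb v₀ z‖)
    {Q : ℕ} (hQ : 2 ≤ Q) {ρ : ℝ} (hρ0 : 0 < ρ) {α : AlgebraicClosure K}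
    (hα : ∀ z ∈ galFinset α, (‖A.emb v₀ z‖ ≤ 1 → ‖A.emb v₀ z ^ Q - A.emb v₀ z‖ ≤ ρ) ∧
      (1 < ‖A.emb v₀ z‖ → 1 ≤ ρ * ‖A.emb v₀ z‖)) {n : ℕ} (hn : (galFinset α).card = n) :
    A.nv v₀ * -Real.log ρ * ∑ j ∈ Finset.range n, ((j / Q : ℕ) : ℝ) ≤
      (∑ v ∈ A.finite_not_isUltrametricDist.toFinset, A.nv v) * (n * Real.log n) +
      p.natDegree * ∑ z ∈ galFinset α, A.locHeight z +
      3 * n / p.natDegree * ∑ z ∈ galFinset α,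
        A.locHeight ((p.map (algebraMap K (AlgebraicClosure K))).eval z) := by
  set D := p.natDegree with hD
  have hDR : (0 : ℝ) < D := by exact_mod_cast hp
  set g : AlgebraicClosure K → AlgebraicClosure K :=
    fun z => (p.map (algebraMap K (AlgebraicClosure K))).eval z with hg
  have hg' : ∀ z, (p.map (algebraMap K (AlgebraicClosure K))).eval z = g z := fun _ => rfl
  simp only [hg'] at hgood ⊢
  have z : Fin n ≃ galFinset α := (Finset.equivFinOfCardEq hn).symm
  have hsum : ∀ F : AlgebraicClosure K → ℝ, ∑ i, F (z i) = ∑ w ∈ galFinset α, F w := fun F => by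
    rw [Equiv.sum_comp z fun w : galFinset α => F w, Finset.sum_coe_sort (galFinset α) F]
  set zz : Fin n → AlgebraicClosure K := fun i => z i with hzz
  have hzinj : Function.Injective zz := Subtype.val_injective.comp z.injective
  have hp0 : p ≠ 0 := by rintro rfl; simp at hD; omega
  have hinj := (algebraMap K (AlgebraicClosure K)).injective
  have hdet := det_mixedPowerMatrix_eval (p.map (algebraMap K (AlgebraicClosure K)))
    ((Polynomial.map_ne_zero_iff hinj).2 hp0) zz
  rw [Polynomial.natDegree_map, Polynomial.leadingCoeff_map, ← hD] at hdet
  simp only [hg'] at hdet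
  set Δ := (mixedPowerMatrix D zz fun i => g (zz i)).det with hΔ
  have hΔ0 : Δ ≠ 0 := by
    rw [hdet]
    refine mul_ne_zero (Matrix.det_vandermonde_ne_zero_iff.2 hzinj)
      (Finset.prod_ne_zero_iff.2 fun j _ => pow_ne_zero _ ?_)
    simpa using hp0
  obtain ⟨x, hx⟩ := exists_algebraMap_eq_det_mixedPowerMatrix_sq z p D
  change _ = Δ ^ 2 at hx
  have hx0 : x ≠ 0 := by
    rintro rfl
    rw [map_zero] at hx
    exact pow_ne_zero 2 hΔ0 hx.symm
  have hxΔ : ∀ v, Real.log ‖A.embK v x‖ = 2 * Real.log ‖A.emb v Δ‖ := fun v => by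
    rw [show A.embK v x = A.emb v Δ ^ 2 by rw [← map_pow, ← hx]; rfl, norm_pow, Real.log_pow]
    norm_cast
  set Arch := A.finite_not_isUltrametricDist.toFinset with hArch
  set S : Finset A.V := {v₀} ∪ Arch ∪ (A.finite_support x hx0).toFinset ∪
    ((galFinset α).biUnion fun w => (A.finite_one_lt_norm_emb w).toFinset) ∪
    ((galFinset α).biUnion fun w => (A.finite_one_lt_norm_emb (g w)).toFinset) with hS
  have hprod := A.sum_nv_mul_log_eq_zero hx0 (S := S) fun v hv => by
    have : v ∈ (A.finite_support x hx0).toFinset := by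
      rw [Set.Finite.mem_toFinset]; exact hv
    simp only [hS, Finset.mem_union]; tauto
  have hLH1 : ∀ w ∈ galFinset α, A.locHeight w = ∑ v ∈ S, A.nv v * logPlus ‖A.emb v w‖ :=
    fun w hw => A.locHeight_eq_sum fun v hv => by
      have : v ∈ (galFinset α).biUnion fun w => (A.finite_one_lt_norm_emb w).toFinset :=
        Finset.mem_biUnion.2 ⟨w, hw, by rw [Set.Finite.mem_toFinset]; exact hv⟩
      simp only [hS, Finset.mem_union]; tauto
  have hLH2 : ∀ w ∈ galFinset α,
      A.locHeight (g w) = ∑ v ∈ S, A.nv v * logPlus ‖A.emb v (g w)‖ :=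
    fun w hw => A.locHeight_eq_sum fun v hv => by
      have : v ∈ (galFinset α).biUnion fun w => (A.finite_one_lt_norm_emb (g w)).toFinset :=
        Finset.mem_biUnion.2 ⟨w, hw, by rw [Set.Finite.mem_toFinset]; exact hv⟩
      simp only [hS, Finset.mem_union]; tauto
  have hloc : ∀ v, Real.log ‖A.emb v Δ‖ ≤ (if v ∈ Arch then n * Real.log n else 0) +
      (D * ∑ w ∈ galFinset α, logPlus ‖A.emb v w‖ +
        3 * n / D * ∑ w ∈ galFinset α, logPlus ‖A.emb v (g w)‖) +
      (if v = v₀ then Real.log ρ * ∑ j ∈ Finset.range n, ((j / Q : ℕ) : ℝ) else 0) := by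
    intro v
    have hs1 : 0 ≤ ∑ w ∈ galFinset α, logPlus ‖A.emb v w‖ :=
      Finset.sum_nonneg fun _ _ => logPlus_nonneg _
    have hs2 : 0 ≤ ∑ w ∈ galFinset α, logPlus ‖A.emb v (g w)‖ :=
      Finset.sum_nonneg fun _ _ => logPlus_nonneg _
    have hvΔ : A.emb v Δ =
        (mixedPowerMatrix D (fun i => A.emb v (zz i)) fun i => A.emb v (g (zz i))).det :=
      RingHom.map_det_mixedPowerMatrix _ _ _ _
    have hvΔ0 : (mixedPowerMatrix D (fun i => A.emb v (zz i))
        fun i => A.emb v (g (zz i))).det ≠ 0 := by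
      rw [← hvΔ]; exact (map_ne_zero _).2 hΔ0
    have hsplit : ∑ i, (D * logPlus ‖A.emb v (zz i)‖ + n / D * logPlus ‖A.emb v (g (zz i))‖) =
        D * ∑ w ∈ galFinset α, logPlus ‖A.emb v w‖ +
        n / D * ∑ w ∈ galFinset α, logPlus ‖A.emb v (g w)‖ := by
      rw [Finset.sum_add_distrib, ← Finset.mul_sum, ← Finset.mul_sum,
        hsum fun w => logPlus ‖A.emb v w‖, hsum fun w => logPlus ‖A.emb v (g w)‖]
    have h3 : n / D * ∑ w ∈ galFinset α, logPlus ‖A.emb v (g w)‖ ≤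
        3 * n / D * ∑ w ∈ galFinset α, logPlus ‖A.emb v (g w)‖ := by
      gcongr
      have : (0 : ℝ) ≤ n := by positivity
      linarith
    by_cases hv0 : v = v₀
    · subst hv0
      have hvA : v ∉ Arch := by
        rw [hArch, Set.Finite.mem_toFinset]; exact fun h => h hu
      rw [if_neg hvA, if_pos rfl]
      have hnorm : ‖A.emb v Δ‖ = ‖(Matrix.vandermonde fun i => A.emb v (zz i)).det‖ := by
        have hl : ‖A.emb v (algebraMap K (AlgebraicClosure K) p.leadingCoeff)‖ = 1 := hlead
        rw [hdet, map_mul, norm_mul, map_prod, norm_prod, Finset.prod_eq_one, mul_one]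
        · rw [Matrix.det_vandermonde, Matrix.det_vandermonde]
          simp only [map_prod, map_sub]
        · intro j _
          rw [map_pow, norm_pow, hl, one_pow]
      have hb := log_norm_det_vandermonde_le hQ hρ0 (y := fun i => A.emb v (zz i))
        ((A.emb v).injective.comp hzinj) fun i => hα _ (z i).2
      rw [hnorm]
      refine hb.trans ?_
      rw [← Finset.mul_sum, hsum fun w => logPlus ‖A.emb v w‖]
      simp only [hgood]
      rw [← Finset.mul_sum]
      have he : 3 * n / D * (D * ∑ w ∈ galFinset α, logPlus ‖A.emb v w‖) =
          3 * n * ∑ w ∈ galFinset α, logPlus ‖A.emb v w‖ := by field_simp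
      rw [he]
      have h4 : 0 ≤ D * ∑ w ∈ galFinset α, logPlus ‖A.emb v w‖ := by positivity
      have h5 : 0 ≤ n * ∑ w ∈ galFinset α, logPlus ‖A.emb v w‖ := by positivity
      linarith
    · rw [if_neg hv0, add_zero, hvΔ]
      by_cases hv : IsUltrametricDist (A.C v).carrier
      · have hvA : v ∉ Arch := by
          rw [hArch, Set.Finite.mem_toFinset]; exact fun h => h hv
        rw [if_neg hvA]
        have := log_norm_det_mixedPowerMatrix_le_of_ultrametric hp hvΔ0
        rw [hsplit] at this
        linarith
      · have hvA : v ∈ Arch := by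
          rw [hArch, Set.Finite.mem_toFinset]; exact hv
        rw [if_pos hvA]
        have := log_norm_det_mixedPowerMatrix_le hp hvΔ0
        rw [hsplit] at this
        linarith
  have hv₀S : v₀ ∈ S := by simp [hS]
  have hArchS : Arch ⊆ S := fun v hv => by simp only [hS, Finset.mem_union]; tauto
  have htot : 0 ≤ ∑ v ∈ S, A.nv v * ((if v ∈ Arch then n * Real.log n else 0) +
      (D * ∑ w ∈ galFinset α, logPlus ‖A.emb v w‖ +
        3 * n / D * ∑ w ∈ galFinset α, logPlus ‖A.emb v (g w)‖) +
      (if v = v₀ then Real.log ρ * ∑ j ∈ Finset.range n, ((j / Q : ℕ) : ℝ) else 0)) := by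
    have h1 : ∑ v ∈ S, A.nv v * Real.log ‖A.emb v Δ‖ = 0 := by
      have : ∑ v ∈ S, A.nv v * Real.log ‖A.embK v x‖ =
          2 * ∑ v ∈ S, A.nv v * Real.log ‖A.emb v Δ‖ := by
        rw [Finset.mul_sum]
        exact Finset.sum_congr rfl fun v _ => by rw [hxΔ]; ring
      linarith
    refine h1.symm.trans_le ?_
    exact Finset.sum_le_sum fun v _ => mul_le_mul_of_nonneg_left (hloc v) (A.nv_pos v).le
  have hcomm : ∀ h : AlgebraicClosure K → AlgebraicClosure K,
      ∑ v ∈ S, A.nv v * ∑ w ∈ galFinset α, logPlus ‖A.emb v (h w)‖ =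
        ∑ w ∈ galFinset α, ∑ v ∈ S, A.nv v * logPlus ‖A.emb v (h w)‖ := fun h => by
    rw [Finset.sum_comm]
    exact Finset.sum_congr rfl fun v _ => Finset.mul_sum _ _ _
  have e1 : ∑ v ∈ S, A.nv v * (if v ∈ Arch then n * Real.log n else 0) =
      (∑ v ∈ Arch, A.nv v) * (n * Real.log n) := by
    simp only [mul_ite, mul_zero]
    rw [← Finset.sum_filter, Finset.filter_mem_eq_inter, Finset.inter_eq_right.2 hArchS,
      Finset.sum_mul]
  have e2 : ∑ v ∈ S, A.nv v * (if v = v₀ then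
      Real.log ρ * ∑ j ∈ Finset.range n, ((j / Q : ℕ) : ℝ) else 0) =
      A.nv v₀ * (Real.log ρ * ∑ j ∈ Finset.range n, ((j / Q : ℕ) : ℝ)) := by
    simp only [mul_ite, mul_zero]
    rw [Finset.sum_ite_eq' S v₀, if_pos hv₀S]
  have hc := hcomm fun w => w
  rw [Finset.sum_congr rfl hLH1, Finset.sum_congr rfl hLH2, ← hc, ← hcomm g,
    Finset.mul_sum _ _ (D : ℝ), Finset.mul_sum _ _ (3 * n / D : ℝ)]
  simp only [mul_add, Finset.sum_add_distrib, e1, e2] at htot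
  have e3 : ∀ (c : ℝ) (F : A.V → ℝ), ∑ v ∈ S, A.nv v * (c * F v) = ∑ v ∈ S, c * (A.nv v * F v) :=
    fun c F => Finset.sum_congr rfl fun v _ => by ring
  rw [e3, e3] at htot
  linarith

end AdelicData

theorem le_sum_range_div {Q : ℕ} (hQ : 0 < Q) (n : ℕ) :
    (n : ℝ) * (((n : ℝ) - 1) / (2 * Q) - 1) ≤ ∑ j ∈ Finset.range n, ((j / Q : ℕ) : ℝ) := by
  have hQ' : (0 : ℝ) < Q := by exact_mod_cast hQ
  induction n with
  | zero => simp
  | succ n ih =>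
    rw [Finset.sum_range_succ]
    have h1 : (n : ℝ) / Q - 1 ≤ ((n / Q : ℕ) : ℝ) := by
      rw [← Nat.floor_div_eq_div (K := ℝ)]
      linarith [Nat.lt_floor_add_one ((n : ℝ) / Q)]
    have h2 : ((n + 1 : ℕ) : ℝ) * ((((n + 1 : ℕ) : ℝ) - 1) / (2 * Q) - 1) =
        n * (((n : ℝ) - 1) / (2 * Q) - 1) + ((n : ℝ) / Q - 1) := by
      push_cast
      field_simp
      ring
    rw [h2]
    linarith

theorem eventually_lt_mul_sum_range_div {Q : ℕ} (hQ : 0 < Q) {κ W D B : ℝ} (hκ : 0 < κ)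
    (hD0 : 0 < D) (hD : 12 * Q * B ≤ D * κ) :
    ∀ᶠ n : ℕ in atTop, W * (n * Real.log n) + D * (n * B) + 3 * n / D * (n * B) <
      κ * ∑ j ∈ Finset.range n, ((j / Q : ℕ) : ℝ) := by
  have hQ' : (0 : ℝ) < Q := by exact_mod_cast hQ
  have hδ : 0 < κ / (8 * Q) := by positivity
  have hlog : ∀ᶠ n : ℕ in atTop, W * Real.log n ≤ κ / (8 * Q) * n := by
    have := ((Real.isLittleO_log_id_atTop.const_mul_left W).comp_tendsto
      tendsto_natCast_atTop_atTop).def hδ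
    filter_upwards [this] with n hn
    simp only [Function.comp, id, Real.norm_eq_abs, Nat.abs_cast] at hn
    exact (le_abs_self _).trans hn
  have hlin : ∀ᶠ n : ℕ in atTop, D * B + κ * (1 / (2 * Q) + 1) < κ / (8 * Q) * n :=
    (tendsto_natCast_atTop_atTop.const_mul_atTop hδ).eventually_gt_atTop _
  filter_upwards [hlog, hlin, eventually_gt_atTop 0] with n h1 h2 hn
  have hn' : (0 : ℝ) < n := by exact_mod_cast hn
  have h3 : 3 * B / D ≤ κ / (4 * Q) := by
    rw [div_le_div_iff₀ hD0 (by positivity)]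
    linarith
  have h4 : 3 * B / D * n ≤ κ / (4 * Q) * n := mul_le_mul_of_nonneg_right h3 hn'.le
  refine lt_of_lt_of_le ?_ (mul_le_mul_of_nonneg_left (le_sum_range_div hQ n) hκ.le)
  have e1 : κ * (n * (((n : ℝ) - 1) / (2 * Q) - 1)) =
      n * (κ / (4 * Q) * n + 2 * (κ / (8 * Q) * n) - κ * (1 / (2 * Q) + 1)) := by
    field_simp
    ring
  have e2 : W * (n * Real.log n) + D * (n * B) + 3 * n / D * (n * B) =
      n * (W * Real.log n + D * B + 3 * B / D * n) := by
    field_simp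
  rw [e1, e2]
  refine mul_lt_mul_of_pos_left ?_ hn'
  linarith

namespace AdelicData

variable {K : Type} [Field K] (A : AdelicData K)

theorem exists_iterate_polynomial {φ : Polynomial K} (hd : 2 ≤ φ.natDegree) {v₀ : A.V}
    (hlead : ‖A.embK v₀ φ.leadingCoeff‖ = 1) (N : ℕ) :
    ∃ p : Polynomial K, p.natDegree = φ.natDegree ^ N ∧ ‖A.embK v₀ p.leadingCoeff‖ = 1 ∧
      ∀ z, (p.map (algebraMap K (AlgebraicClosure K))).eval z =
        polyIter (φ.map (algebraMap K (AlgebraicClosure K))) N z := by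
  induction N with
  | zero => exact ⟨Polynomial.X, by simp, by simp, fun z => by simp [polyIter]⟩
  | succ N ih =>
    obtain ⟨p, h1, h2, h3⟩ := ih
    refine ⟨φ.comp p, ?_, ?_, fun z => ?_⟩
    · rw [Polynomial.natDegree_comp, h1, pow_succ']
    · have : p.natDegree ≠ 0 := by rw [h1]; positivity
      rw [Polynomial.leadingCoeff_comp this, map_mul, map_pow, norm_mul, norm_pow, h2, hlead,
        one_pow, one_mul]
    · rw [Polynomial.map_comp, Polynomial.eval_comp, h3]
      simp only [polyIter, Function.iterate_succ_apply']

theorem logPlus_emb_polyIter {φ : Polynomial K} {v : A.V} (hv : v ∉ A.badPlaces φ) (N : ℕ)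
    (z : AlgebraicClosure K) :
    logPlus ‖A.emb v (polyIter (φ.map (algebraMap K (AlgebraicClosure K))) N z)‖ =
      ((φ.natDegree ^ N : ℕ) : ℝ) * logPlus ‖A.emb v z‖ := by
  induction N with
  | zero => simp [polyIter]
  | succ N ih =>
    have h := A.logPlus_emb_eval_eq hv
      (polyIter (φ.map (algebraMap K (AlgebraicClosure K))) N z)
    rw [ih] at h
    simp only [polyIter, Function.iterate_succ_apply'] at h ⊢
    rw [h]
    push_cast
    ring

theorem card_mul_heightAlg (α : AlgebraicClosure K) :
    ∑ z ∈ galFinset α, A.locHeight z = (galFinset α).card * A.heightAlg α := by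
  have : ((galFinset α).card : ℝ) ≠ 0 := by exact_mod_cast (card_galFinset_pos α).ne'
  rw [heightAlg_eq, mul_inv_cancel_left₀ this]

theorem card_mul_heightAlg_polyIter (φ : Polynomial K) (N : ℕ) (α : AlgebraicClosure K) :
    ∑ z ∈ galFinset α,
        A.locHeight (polyIter (φ.map (algebraMap K (AlgebraicClosure K))) N z) =
      (galFinset α).card *
        A.heightAlg (polyIter (φ.map (algebraMap K (AlgebraicClosure K))) N α) := by
  have : ((galFinset α).card : ℝ) ≠ 0 := by exact_mod_cast (card_galFinset_pos α).ne'
  rw [heightAlg, ← image_galOrbit_of_commute (fun σ z => map_polyIter φ N σ z) α,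
    A.heightSet_image_galOrbit (fun σ z => map_polyIter φ N σ z), mul_inv_cancel_left₀ this]

/-- If the absolute value at `v` restricted to `K` is trivial, elements of type `(e, f)` have
degree at most `f`. -/
theorem natDegree_minpoly_le_of_trivial [NumberField K] {v : A.V}
    [IsUltrametricDist (A.C v).carrier] {Kv : Subfield (A.C v).carrier}
    (hKv : (Kv : Set (A.C v).carrier) = closure (Set.range (A.embK v)))
    (hm : ∀ n : ℤ, ¬ (0 : ℤ) ∣ n → ‖(n : (A.C v).carrier)‖ = 1) {e f : ℕ}
    {α : AlgebraicClosure K} (hα : TotallyVadicOfType A v Kv e f α) :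
    (minpoly K α).natDegree ≤ f := by
  obtain ⟨E, hKvE, -, hram, hres, hE⟩ := hα (A.emb v) fun _ => rfl
  obtain ⟨p, hp0, hpf, hp⟩ := exists_polynomial_of_trivial hKv hm hKvE hram hres
    (hE α (IntermediateField.mem_adjoin_simple_self K α))
  refine (Polynomial.natDegree_le_of_dvd (minpoly.dvd K α ?_) hp0).trans hpf
  refine (A.emb v).injective ?_
  rw [map_zero, ← hp, Polynomial.aeval_def, Polynomial.hom_eval₂]
  rfl

end AdelicData

namespace AdelicData

variable {K : Type} [Field K] (A : AdelicData K)

/-- Uniform bound for the degrees of totally `v`-adic elements of type `(e, f)` of small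
canonical height. -/
theorem exists_natDegree_minpoly_le [NumberField K] {φ : Polynomial K} (hd : 2 ≤ φ.natDegree)
    {v₀ : A.V} [IsUltrametricDist (A.C v₀).carrier]
    (hgood₁ : ∀ i : ℕ, ‖A.embK v₀ (φ.coeff i)‖ ≤ 1)
    (hgood₂ : ‖A.embK v₀ φ.leadingCoeff‖ = 1)
    {Kv : Subfield (A.C v₀).carrier}
    (hKv : (Kv : Set (A.C v₀).carrier) = closure (Set.range (A.embK v₀)))
    {e : ℕ} (he : 0 < e) (f : ℕ) (B : ℝ) :
    ∃ N n₀ : ℕ, ∀ α : AlgebraicClosure K, TotallyVadicOfType A v₀ Kv e f α →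
      A.heightAlg α ≤ B →
      A.heightAlg (polyIter (φ.map (algebraMap K (AlgebraicClosure K))) N α) ≤ B →
      (minpoly K α).natDegree ≤ n₀ := by
  obtain ⟨m, hm1, hmlt, hm⟩ := exists_generator_of_norm_lt_one (A.C v₀).carrier
  rcases eq_or_ne m 0 with rfl | hm0
  · exact ⟨0, f, fun α hα _ _ => A.natDegree_minpoly_le_of_trivial hKv (by simpa using hm) hα⟩
  obtain ⟨Q, ρ, hQ, hρ0, hρ1, hE⟩ := exists_uniform_contraction hKv hm1 hm0 hmlt hm he f
  set κ : ℝ := A.nv v₀ * -Real.log ρ with hκ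
  have hκ0 : 0 < κ := mul_pos (A.nv_pos v₀) (neg_pos.2 (Real.log_neg hρ0 hρ1))
  obtain ⟨N, hN⟩ := pow_unbounded_of_one_lt (12 * Q * B / κ)
    (show (1 : ℝ) < φ.natDegree by exact_mod_cast hd)
  have hD0 : (0 : ℝ) < (φ.natDegree : ℝ) ^ N := by positivity
  rw [div_lt_iff₀ hκ0] at hN
  obtain ⟨n₀, hn₀⟩ := eventually_atTop.1 (eventually_lt_mul_sum_range_div (Q := Q) (by omega)
    (W := ∑ v ∈ A.finite_not_isUltrametricDist.toFinset, A.nv v) hκ0 hD0 hN.le)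
  obtain ⟨p, hpdeg, hplead, hpeval⟩ := A.exists_iterate_polynomial hd hgood₂ N
  have hbad : v₀ ∉ A.badPlaces φ := by
    simp only [badPlaces, Set.mem_ofPred_eq, not_not]
    exact ⟨inferInstance, hgood₁, hgood₂⟩
  refine ⟨N, n₀, fun α hα h1 h2 => ?_⟩
  rw [← card_galFinset]
  by_contra! hlt
  have hcontr : ∀ z ∈ galFinset α,
      (‖A.emb v₀ z‖ ≤ 1 → ‖A.emb v₀ z ^ Q - A.emb v₀ z‖ ≤ ρ) ∧
      (1 < ‖A.emb v₀ z‖ → 1 ≤ ρ * ‖A.emb v₀ z‖) := by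
    intro z hz
    obtain ⟨σ, rfl⟩ := mem_galFinset.1 hz
    obtain ⟨E, -, -, hram, hres, hadj⟩ := hα ((A.emb v₀).comp (σ : AlgebraicClosure K →+* _))
      fun x => by simp [embK]
    exact hE E hram hres _ (hadj α (IntermediateField.mem_adjoin_simple_self K α))
  have key := A.mul_sum_div_le (p := p) (by rw [hpdeg]; positivity) inferInstance hplead
    (fun z => by rw [hpeval, hpdeg]; exact A.logPlus_emb_polyIter hbad N z) hQ hρ0 hcontr rfl
  simp only [hpeval, hpdeg, card_mul_heightAlg, card_mul_heightAlg_polyIter] at key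
  push_cast at key
  have hbound := hn₀ _ hlt.le
  refine (key.trans ?_).not_gt hbound
  gcongr

end AdelicData

/-- Let `K` be a number field, `φ ∈ K[z]` of degree `d ≥ 2`, and `v` a
non-archimedean place of good reduction for `φ` (all coefficients have `|·|_v ≤ 1` and the
leading coefficient has `|·|_v = 1`).  Let `K_v` be the closure of `K` in `C_v`, and fix
positive integers `e, f`.  Then there is a constant `C > 0` such that `ĥ_φ(α) ≥ C` for all
but finitely many `α ∈ K̄` which are totally `v`-adic of type `(e,f)`; in particular only
finitely many preperiodic points of `φ` are totally `v`-adic of type `(e,f)`. -/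
theorem stmt15 {K : Type} [Field K] [NumberField K] (A : AdelicData K)
    (hN : A.Northcott)
    (φ : Polynomial K) (hd : 2 ≤ φ.natDegree)
    (v0 : A.V)
    (hna : ∀ x y : (A.C v0).carrier, ‖x + y‖ ≤ max ‖x‖ ‖y‖)
    (hgood₁ : ∀ i : ℕ, ‖A.embK v0 (φ.coeff i)‖ ≤ 1)
    (hgood₂ : ‖A.embK v0 φ.leadingCoeff‖ = 1)
    (Kv : Subfield (A.C v0).carrier)
    (hKv : (Kv : Set (A.C v0).carrier) = closure (Set.range (A.embK v0)))
    (e f : ℕ) (he : 0 < e) (hf : 0 < f) :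
    (∃ C > (0 : ℝ),
      {α : AlgebraicClosure K | TotallyVadicOfType A v0 Kv e f α ∧
        A.canonicalHeightAlg φ α < C}.Finite) ∧
    {α : AlgebraicClosure K | TotallyVadicOfType A v0 Kv e f α ∧
      IsPreperiodicAlg φ α}.Finite := by
  have : IsUltrametricDist (A.C v0).carrier :=
    IsUltrametricDist.isUltrametricDist_of_forall_norm_add_le_max_norm hna
  obtain ⟨c, -, hc⟩ := A.exists_tendsto_canonicalHeightAlg hd
  obtain ⟨N, n₀, hn₀⟩ :=
    A.exists_natDegree_minpoly_le hd hgood₁ hgood₂ hKv he f (1 + c)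
  have hD : (1 : ℝ) ≤ (φ.natDegree : ℝ) ^ N :=
    one_le_pow₀ (by exact_mod_cast (by omega : 1 ≤ φ.natDegree))
  have hC : (0 : ℝ) < ((φ.natDegree : ℝ) ^ N)⁻¹ := inv_pos.2 (by linarith)
  have hfin : {α : AlgebraicClosure K | TotallyVadicOfType A v0 Kv e f α ∧
      A.canonicalHeightAlg φ α < ((φ.natDegree : ℝ) ^ N)⁻¹}.Finite := by
    refine (hN n₀ (1 + c)).subset ?_
    rintro α ⟨hα, hlt⟩
    have h0 : A.heightAlg α ≤ 1 + c := by
      have := (abs_le.1 ((hc α).2 0)).1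
      simp only [pow_zero, inv_one, one_mul, polyIter, Function.iterate_zero, id] at this
      have := inv_le_one_of_one_le₀ hD
      linarith
    have h1 : A.heightAlg (polyIter (φ.map (algebraMap K (AlgebraicClosure K))) N α) ≤
        1 + c := by
      have := (abs_le.1 ((hc α).2 N)).1
      refine le_of_mul_le_mul_left ?_ hC
      linarith
    exact ⟨hn₀ α hα h0 h1, h0⟩
  refine ⟨⟨_, hC, hfin⟩, hfin.subset ?_⟩
  rintro α ⟨hα, hpre⟩
  exact ⟨hα, by rwa [A.canonicalHeightAlg_eq_zero_of_isPreperiodicAlg hd hpre]⟩
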